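/- arXiv:2310.18971 — 2 statements merged into one kernel-verified Lean document; each statement's English description precedes it below -/
import Mathlib

section
/- Let f : G → G be a graph map and let K be an f-invariant connected closed subset of G with ∂_G K ∩ P(f) = ∅. Then: (1) there exists an f-invariant connected open set L ⊇ K such that O₋(L,f) = O₋(K,f) and Ab(L,f) = Ab(K,f); (2) O₋(K,f) and Ab(K,f) are open in G; (3) for every y ∈ O₋(K,f) there exist m ≥ 1 and a neighborhood Z of y in G such that fⁱ(Z) ⊆ K for all i ≥ m; (4) ω(f) ∩ O₋(K,f) = ω(f) ∩ Ab(K,f) = ω(f) ∩ K = ω(f|K); (5) Ω(f) ∩ O₋(K,f) = Ω(f) ∩ Ab(K,f) = Ω(f) ∩ K ⊆ Ω(f|K) ∪ ∂_G K. -/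
open Set Function Filter Topology Metric

noncomputable section

/-- An open arc: a subspace homeomorphic to the open interval `(0,1)`. -/
def IsOpenArc {G : Type*} [TopologicalSpace G] (A : Set G) : Prop :=
  Nonempty (A ≃ₜ Set.Ioo (0 : ℝ) 1)

/-- A circle: a subspace homeomorphic to the unit circle. -/
def IsCircle {G : Type*} [TopologicalSpace G] (C : Set G) : Prop :=
  Nonempty (C ≃ₜ Metric.sphere (0 : ℂ) 1)

/-- A (topological) graph: a non-degenerate compact connected metric space with a finite
vertex set `V` such that every connected component of the complement of `V` is an open arc,
and every circle contains at least three vertices. -/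
structure IsTopGraph {G : Type*} [MetricSpace G] (V : Set G) : Prop where
  nontrivial : Nontrivial G
  compact : CompactSpace G
  connected : ConnectedSpace G
  finite_vertexSet : V.Finite
  component_openArc : ∀ x ∈ Vᶜ, IsOpenArc (connectedComponentIn Vᶜ x)
  circle_vertices : ∀ C : Set G, IsCircle C → 3 ≤ (C ∩ V).ncard

/-- The set of eventually periodic points: points with finite orbit. -/
def evPeriodicPts {G : Type*} (f : G → G) : Set G :=
  {x | (Set.range fun n : ℕ => f^[n] x).Finite}

/-- `EP_n(f)`: points whose orbit contains at most `n` points. -/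
def evPeriodicPtsLe {G : Type*} (f : G → G) (n : ℕ) : Set G :=
  {x | (Set.range fun i : ℕ => f^[i] x).encard ≤ n}

/-- The ω-limit set of a point `x` under `f`. -/
def omegaSet {G : Type*} [TopologicalSpace G] (f : G → G) (x : G) : Set G :=
  ⋂ i : ℕ, closure (Set.range fun n : ℕ => f^[n + i] x)

/-- The ω-limit set of `f`. -/
def omegaLimitSet {G : Type*} [TopologicalSpace G] (f : G → G) : Set G :=
  ⋃ x : G, omegaSet f x

/-- The set of recurrent points of `f`. -/
def recurrentPts {G : Type*} [TopologicalSpace G] (f : G → G) : Set G :=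
  {x | x ∈ omegaSet f x}

/-- The set of non-wandering points of `f`. -/
def nonwanderingPts {G : Type*} [TopologicalSpace G] (f : G → G) : Set G :=
  {x | ∀ U : Set G, IsOpen U → x ∈ U → ∃ n : ℕ, 0 < n ∧ (f^[n] '' U ∩ U).Nonempty}

/-- The set of almost periodic points of `f`. -/
def almostPeriodicPts {G : Type*} [TopologicalSpace G] (f : G → G) : Set G :=
  {x | ∀ U : Set G, IsOpen U → x ∈ U →
    ∃ m : ℕ, 0 < m ∧ ∀ n : ℕ, ∃ i : ℕ, 1 ≤ i ∧ i ≤ m ∧ f^[n + i] x ∈ U}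

/-- The ω-limit set of `x` under the restriction `f|K` (closures taken in the subspace `K`). -/
def omegaSetIn {G : Type*} [TopologicalSpace G] (f : G → G) (K : Set G) (x : G) : Set G :=
  ⋂ i : ℕ, (closure (Set.range fun n : ℕ => f^[n + i] x) ∩ K)

/-- The ω-limit set `ω(f|K)` of the restriction of `f` to `K`. -/
def omegaLimitSetIn {G : Type*} [TopologicalSpace G] (f : G → G) (K : Set G) : Set G :=
  ⋃ x ∈ K, omegaSetIn f K x

/-- The non-wandering set `Ω(f|K)` of the restriction of `f` to `K`. -/
def nonwanderingPtsIn {G : Type*} [TopologicalSpace G] (f : G → G) (K : Set G) : Set G :=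
  {x | x ∈ K ∧ ∀ U : Set G, IsOpen U → x ∈ U →
    ∃ n : ℕ, 0 < n ∧ (f^[n] '' (U ∩ K) ∩ (U ∩ K)).Nonempty}

/-- The almost periodic set `AP(f|K)` of the restriction of `f` to `K`. -/
def almostPeriodicPtsIn {G : Type*} [TopologicalSpace G] (f : G → G) (K : Set G) : Set G :=
  {x | x ∈ K ∧ ∀ U : Set G, IsOpen U → x ∈ U →
    ∃ m : ℕ, 0 < m ∧ ∀ n : ℕ, ∃ i : ℕ, 1 ≤ i ∧ i ≤ m ∧ f^[n + i] x ∈ U}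

/-- The orbit `O(K,f)` of a set `K` under `f`. -/
def setOrbit {G : Type*} (f : G → G) (K : Set G) : Set G := ⋃ i : ℕ, f^[i] '' K

/-- The orbit segment `O_n(K,f)`. -/
def setOrbitSeg {G : Type*} (f : G → G) (K : Set G) (n : ℕ) : Set G :=
  ⋃ i ≤ n, f^[i] '' K

/-- The inverse orbit (absorbed set) `O₋(K,f)`. -/
def invOrbit {G : Type*} (f : G → G) (K : Set G) : Set G := ⋃ i : ℕ, f^[i] ⁻¹' K

/-- The main absorbed set `Ab(K,f)`: the union of the connected components of `O₋(K,f)`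
that meet `K`. -/
def mainAbsorbed {G : Type*} [TopologicalSpace G] (f : G → G) (K : Set G) : Set G :=
  ⋃ x ∈ K, connectedComponentIn (invOrbit f K) x

/-- A minimal set of `f`: nonempty, closed, invariant, with no proper such subset. -/
def IsMinimalSet {G : Type*} [TopologicalSpace G] (f : G → G) (M : Set G) : Prop :=
  M.Nonempty ∧ IsClosed M ∧ f '' M ⊆ M ∧
    ∀ N : Set G, N ⊆ M → N.Nonempty → IsClosed N → f '' N ⊆ N → N = M

open Classical in
/-- The valence of a point `x` in a metric space: the limit, as `r → 0⁺`, of the number of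
boundary points of the ball `B(x,r)` (defined as the eventual value, if it exists). -/
def valence {G : Type*} [MetricSpace G] (x : G) : ℕ :=
  if h : ∃ n : ℕ, ∀ᶠ r in nhdsWithin (0 : ℝ) (Set.Ioi 0),
      (frontier (Metric.ball x r)).ncard = n
  then h.choose else 0

/-- The set of branching points. -/
def branchPts (G : Type*) [MetricSpace G] : Set G := {x | 2 < valence x}

/-- The total branching number `ξ(U)` of a subset `U` of `G`. -/
def totalBranch {G : Type*} [MetricSpace G] (U : Set G) : ℕ :=
  ∑ᶠ v ∈ U ∩ branchPts G, (valence v - 2)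

/-- Cyclic successor on `Fin k`. -/
def finSucc {k : ℕ} (i : Fin k) : Fin k := ⟨(i.1 + 1) % k, Nat.mod_lt _ i.pos⟩

/-- `C : Fin k → Set G` enumerates the connected components of `X`, and `f` maps each
component into the (cyclically) next one. -/
def IsCyclicDecomp {G : Type*} [TopologicalSpace G] (f : G → G) (X : Set G)
    {k : ℕ} (C : Fin k → Set G) : Prop :=
  (⋃ i, C i) = X ∧ (∀ i, (C i).Nonempty) ∧
  (∀ i, ∀ x ∈ C i, connectedComponentIn X x = C i) ∧
  Function.Injective C ∧ ∀ i, f '' C i ⊆ C (finSucc i)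

/-- A component-cyclic `f`-invariant set. -/
def ComponentCyclic {G : Type*} [TopologicalSpace G] (f : G → G) (X : Set G) : Prop :=
  ∃ (k : ℕ) (C : Fin k → Set G), 0 < k ∧ IsCyclicDecomp f X C

/-- `A` is a connected component of `S`. -/
def IsCompOf {G : Type*} [TopologicalSpace G] (A S : Set G) : Prop :=
  ∃ x ∈ S, connectedComponentIn S x = A

/-- The distance between two sets. -/
def setDist {G : Type*} [MetricSpace G] (A B : Set G) : ℝ :=
  sInf {r : ℝ | ∃ a ∈ A, ∃ b ∈ B, dist a b = r}

end

/-! ### Topology of graphs -/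

section Arcs

variable {G : Type*} [MetricSpace G]

/-- `γ` parametrizes the open arc `A` on `(0,1)`, with continuous inverse `g`, and extends
continuously to `[0,1]` with endpoints in `V`. -/
structure IsEdgeChart (V A : Set G) (γ : ℝ → G) (g : G → ℝ) : Prop where
  continuousOn : ContinuousOn γ (Icc 0 1)
  continuousOn_inv : ContinuousOn g A
  mem_of_mem_Ioo : ∀ t ∈ Ioo (0 : ℝ) 1, γ t ∈ A
  inv_mem : ∀ x ∈ A, g x ∈ Ioo (0 : ℝ) 1
  left_inv : ∀ t ∈ Ioo (0 : ℝ) 1, g (γ t) = t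
  right_inv : ∀ x ∈ A, γ (g x) = x
  zero_mem : γ 0 ∈ V
  one_mem : γ 1 ∈ V

theorem exists_tendsto_end_of_arc [CompactSpace G] {A V : Set G} (hV : V.Finite)
    (hAV : closure A ⊆ A ∪ V) {h : ℝ → G} {g : G → ℝ}
    (hh : ContinuousOn h (Ioo 0 1)) (hg : ContinuousOn g A)
    (hA : ∀ t ∈ Ioo (0 : ℝ) 1, h t ∈ A) (hgA : ∀ x ∈ A, g x ∈ Ioo (0 : ℝ) 1)
    (hgh : ∀ t ∈ Ioo (0 : ℝ) 1, g (h t) = t) :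
    ∃ v ∈ V, Tendsto h (𝓝[>] 0) (𝓝 v) := by
  have hIoo : ∀ ε : ℝ, 0 < ε → ∀ᶠ t in 𝓝[>] (0 : ℝ), t ∈ Ioo 0 ε := fun ε hε =>
    Ioo_mem_nhdsGT hε
  have hclust : ∀ c, MapClusterPt c (𝓝[>] (0 : ℝ)) h → c ∈ V := by
    intro c hc
    have hcA : c ∈ closure A := by
      rw [mem_closure_iff_clusterPt]
      refine ClusterPt.mono hc ?_
      rw [le_principal_iff, mem_map]
      filter_upwards [hIoo 1 one_pos] with t ht using hA t ht
    rcases hAV hcA with hc' | hc'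
    · exfalso
      have h1 : ∀ᶠ y in 𝓝[A] c, g c / 2 < g y :=
        (hg c hc').eventually (lt_mem_nhds (by linarith [(hgA c hc').1]))
      rw [eventually_nhdsWithin_iff] at h1
      have h2 := hc.frequently h1
      have h3 : ∀ᶠ t in 𝓝[>] (0 : ℝ), ¬ (h t ∈ A → g c / 2 < g (h t)) := by
        filter_upwards [hIoo 1 one_pos, hIoo (g c / 2) (by linarith [(hgA c hc').1])]
          with t ht ht'
        intro H
        have := H (hA t ht)
        rw [hgh t ht] at this
        linarith [ht'.2]
      exact h2 h3
    · exact hc'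
  obtain ⟨v, hv⟩ := exists_clusterPt_of_compactSpace (map h (𝓝[>] (0 : ℝ)))
  have hvV : v ∈ V := hclust v hv
  refine ⟨v, hvV, Metric.tendsto_nhds.2 fun ε hε => ?_⟩
  obtain ⟨r, hr, hrV⟩ : (Ioo 0 ε \ ((fun w => dist w v) '' V)).Nonempty :=
    ((Ioo_infinite hε).sdiff (hV.image _)).nonempty
  suffices hlt : ∀ᶠ t in 𝓝[>] (0 : ℝ), dist (h t) v < r from
    hlt.mono fun t ht => ht.trans hr.2
  by_contra hcon
  have hge : ∃ᶠ t in 𝓝[>] (0 : ℝ), ¬ dist (h t) v < r := by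
    rwa [← not_eventually]
  have hlt : ∃ᶠ t in 𝓝[>] (0 : ℝ), dist (h t) v < r :=
    MapClusterPt.frequently hv (Metric.ball_mem_nhds v hr.1)
  have heq : ∃ᶠ t in 𝓝[>] (0 : ℝ), h t ∈ sphere v r := by
    rw [(nhdsGT_basis (0 : ℝ)).frequently_iff] at hge hlt ⊢
    intro δ hδ
    obtain ⟨s, hs, hs'⟩ := hge (i := min δ 1) (lt_min hδ one_pos)
    obtain ⟨t, ht, ht'⟩ := hlt (i := min δ 1) (lt_min hδ one_pos)
    have hcont : ContinuousOn (fun t => dist (h t) v) (Ioo 0 (min δ 1)) :=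
      (continuous_id.dist continuous_const).comp_continuousOn
        (hh.mono (Ioo_subset_Ioo_right (min_le_right _ _)))
    obtain ⟨u, hu, hu'⟩ := isPreconnected_Ioo.intermediate_value ht hs hcont
      ⟨ht'.le, not_lt.1 hs'⟩
    exact ⟨u, ⟨hu.1, hu.2.trans_le (min_le_left _ _)⟩, hu'⟩
  obtain ⟨c, hc, hc'⟩ := (isCompact_sphere v r).exists_mapClusterPt_of_frequently heq
  exact hrV ⟨c, hclust c hc', hc⟩

theorem IsOpenArc.exists_isEdgeChart [CompactSpace G] {A V : Set G} (hA : IsOpenArc A)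
    (hV : V.Finite) (hAV : closure A ⊆ A ∪ V) : ∃ γ g, IsEdgeChart V A γ g := by
  classical
  obtain ⟨φ⟩ := hA
  have hhalf : (1 / 2 : ℝ) ∈ Ioo (0 : ℝ) 1 := by norm_num
  have hne : Nonempty G := ⟨φ.symm ⟨1 / 2, hhalf⟩⟩
  let h : ℝ → G := fun t => if ht : t ∈ Ioo (0 : ℝ) 1 then φ.symm ⟨t, ht⟩ else hne.some
  let g : G → ℝ := fun x => if hx : x ∈ A then φ ⟨x, hx⟩ else 0
  have hφh : ∀ t (ht : t ∈ Ioo (0 : ℝ) 1), h t = φ.symm ⟨t, ht⟩ := fun t ht => dif_pos ht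
  have hφg : ∀ x (hx : x ∈ A), g x = φ ⟨x, hx⟩ := fun x hx => dif_pos hx
  have hh : ContinuousOn h (Ioo 0 1) := by
    rw [continuousOn_iff_continuous_domRestrict]
    have : (Ioo (0 : ℝ) 1).domRestrict h = fun t => (φ.symm t : G) := by
      ext t; exact hφh t t.2
    rw [this]; fun_prop
  have hg : ContinuousOn g A := by
    rw [continuousOn_iff_continuous_domRestrict]
    have : A.domRestrict g = fun x => (φ x : ℝ) := by
      ext t; exact hφg t t.2
    rw [this]; fun_prop
  have hmem : ∀ t ∈ Ioo (0 : ℝ) 1, h t ∈ A := fun t ht => by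
    rw [hφh t ht]; exact Subtype.coe_prop _
  have hgmem : ∀ x ∈ A, g x ∈ Ioo (0 : ℝ) 1 := fun x hx => by
    rw [hφg x hx]; exact Subtype.coe_prop _
  have hgh : ∀ t ∈ Ioo (0 : ℝ) 1, g (h t) = t := fun t ht => by
    rw [hφg _ (hmem t ht)]
    simp [hφh t ht]
  have hhg : ∀ x ∈ A, h (g x) = x := fun x hx => by
    rw [hφh _ (hgmem x hx)]
    simp [hφg x hx]
  obtain ⟨v, hv, hvt⟩ := exists_tendsto_end_of_arc hV hAV hh hg hmem hgmem hgh
  have hflip : ∀ t ∈ Ioo (0 : ℝ) 1, 1 - t ∈ Ioo (0 : ℝ) 1 := fun t ht =>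
    ⟨by linarith [ht.2], by linarith [ht.1]⟩
  obtain ⟨w, hw, hwt⟩ := exists_tendsto_end_of_arc (h := fun t => h (1 - t))
    (g := fun x => 1 - g x) hV hAV
    (hh.comp (by fun_prop) hflip) (continuousOn_const.sub hg)
    (fun t ht => hmem _ (hflip t ht)) (fun x hx => hflip _ (hgmem x hx))
    (fun t ht => by rw [hgh _ (hflip t ht)]; ring)
  have hwt' : Tendsto h (𝓝[<] 1) (𝓝 w) := by
    have hsub : Tendsto (fun t : ℝ => 1 - t) (𝓝[<] 1) (𝓝[>] 0) := by
      refine tendsto_nhdsWithin_iff.2 ⟨?_, ?_⟩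
      · have : Tendsto (fun t : ℝ => 1 - t) (𝓝 1) (𝓝 (1 - 1)) :=
          (continuous_const.sub continuous_id).tendsto _
        rw [sub_self] at this
        exact this.mono_left nhdsWithin_le_nhds
      · filter_upwards [self_mem_nhdsWithin] with t ht
        exact sub_pos.2 (mem_Iio.1 ht)
    simpa [Function.comp_def] using hwt.comp hsub
  have heq : ∀ t ∈ Ioo (0 : ℝ) 1, extendFrom (Ioo 0 1) h t = h t := extendFrom_extends hh
  refine ⟨extendFrom (Ioo 0 1) h, g, continuousOn_Icc_extendFrom_Ioo hh hvt hwt', hg,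
    fun t ht => by rw [heq t ht]; exact hmem t ht, hgmem,
    fun t ht => by rw [heq t ht]; exact hgh t ht,
    fun x hx => by rw [heq _ (hgmem x hx)]; exact hhg x hx, ?_, ?_⟩
  · rwa [eq_lim_at_left_extendFrom_Ioo one_pos hvt]
  · rwa [eq_lim_at_right_extendFrom_Ioo one_pos hwt']

theorem isCircle_image_Icc {X : Type*} [TopologicalSpace X] [T2Space X] {p : ℝ} (hp : 0 < p)
    {γ : ℝ → X} (hγ : ContinuousOn γ (Icc 0 p)) (hinj : InjOn γ (Ico 0 p)) (h0 : γ 0 = γ p) :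
    IsCircle (γ '' Icc 0 p) := by
  have : Fact (0 < p) := ⟨hp⟩
  let F : AddCircle p → X := AddCircle.liftIco p 0 γ
  have hF : Continuous F := AddCircle.liftIco_continuous (by simpa using h0) (by simpa using hγ)
  have happly : ∀ t ∈ Ico 0 p, F (t : AddCircle p) = γ t := fun t ht =>
    AddCircle.liftIco_coe_apply (by simpa using ht)
  have hsurj : ∀ y : AddCircle p, ∃ t ∈ Ico 0 p, (t : AddCircle p) = y := fun y => by
    have := AddCircle.coe_image_Ico_eq p 0
    rw [zero_add] at this
    exact (this ▸ mem_univ y : y ∈ _)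
  have hFinj : Injective F := by
    intro x y hxy
    obtain ⟨s, hs, rfl⟩ := hsurj x
    obtain ⟨t, ht, rfl⟩ := hsurj y
    rw [happly s hs, happly t ht] at hxy
    rw [hinj hs ht hxy]
  have hrange : range F = γ '' Icc 0 p := by
    ext x
    constructor
    · rintro ⟨y, rfl⟩
      obtain ⟨t, ht, rfl⟩ := hsurj y
      exact ⟨t, Ico_subset_Icc_self ht, (happly t ht).symm⟩
    · rintro ⟨t, ht, rfl⟩
      rcases ht.2.lt_or_eq with h | h
      · exact ⟨t, happly t ⟨ht.1, h⟩⟩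
      · subst h
        exact ⟨(0 : ℝ), (happly 0 ⟨le_rfl, hp⟩).trans h0⟩
  have hemb : IsEmbedding F := (hF.isClosedEmbedding hFinj).isEmbedding
  let e : sphere (0 : ℂ) 1 ≃ₜ Circle := Homeomorph.refl _
  exact ⟨(Homeomorph.setCongr hrange.symm).trans
    (hemb.toHomeomorph.symm.trans ((AddCircle.homeomorphCircle hp.ne').trans e.symm))⟩

theorem locallyConnectedSpace_of_finite_cover_arcs {X ι : Type*} [TopologicalSpace X] [T2Space X]
    [Finite ι] (γ : ι → ℝ → X) (hγ : ∀ i, ContinuousOn (γ i) (Icc 0 1))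
    (hcov : ∀ x, ∃ i, ∃ t ∈ Icc (0 : ℝ) 1, γ i t = x) : LocallyConnectedSpace X := by
  let : TopologicalSpace ι := ⊥
  have : DiscreteTopology ι := ⟨rfl⟩
  have : LocallyConnectedSpace unitInterval := by
    have : IsQuotientMap (projIcc (0 : ℝ) 1 zero_le_one) := isQuotientMap_projIcc
    exact this.isCoinducing.locallyConnectedSpace
  let F : ι × unitInterval → X := fun p => γ p.1 p.2
  have hF : Continuous F := by
    rw [continuous_prod_of_discrete_left]
    intro i
    exact continuousOn_iff_continuous_domRestrict.1 (hγ i)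
  have hsurj : Surjective F := fun x => by
    obtain ⟨i, t, ht, rfl⟩ := hcov x
    exact ⟨(i, ⟨t, ht⟩), rfl⟩
  exact (hF.isClosedMap.isQuotientMap hF hsurj).isCoinducing.locallyConnectedSpace

end Arcs

section Graph

variable {G : Type*} [MetricSpace G] {V : Set G}

/-- The edges of a graph with vertex set `V`: the components of the complement of `V`. -/
def graphEdges (V : Set G) : Set (Set G) := {A | IsCompOf A Vᶜ}

theorem disjoint_vertices_of_mem_graphEdges {A : Set G} (hA : A ∈ graphEdges V) :
    ∀ x ∈ A, x ∉ V := by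
  obtain ⟨x, -, rfl⟩ := hA
  exact fun y hy => connectedComponentIn_subset _ _ hy

theorem eq_of_mem_graphEdges {A B : Set G} (hA : A ∈ graphEdges V) (hB : B ∈ graphEdges V)
    {x : G} (hxA : x ∈ A) (hxB : x ∈ B) : A = B := by
  obtain ⟨a, -, rfl⟩ := hA
  obtain ⟨b, -, rfl⟩ := hB
  rw [connectedComponentIn_eq hxA, connectedComponentIn_eq hxB]

theorem closure_subset_of_mem_graphEdges {A : Set G} (hA : A ∈ graphEdges V) :
    closure A ⊆ A ∪ V := by
  obtain ⟨a, ha, rfl⟩ := hA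
  intro y hy
  by_cases hyV : y ∈ V
  · exact Or.inr hyV
  · left
    have hpre : IsPreconnected (insert y (connectedComponentIn Vᶜ a)) :=
      isPreconnected_connectedComponentIn.subset_closure (subset_insert _ _)
        (insert_subset hy subset_closure)
    exact hpre.subset_connectedComponentIn (mem_insert_of_mem _ (mem_connectedComponentIn ha))
      (insert_subset hyV (connectedComponentIn_subset _ _)) (mem_insert _ _)

theorem IsTopGraph.exists_isEdgeChart (hG : IsTopGraph V) {A : Set G}
    (hA : A ∈ graphEdges V) : ∃ γ g, IsEdgeChart V A γ g := by
  have := hG.compact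
  have hcl := closure_subset_of_mem_graphEdges hA
  obtain ⟨a, ha, rfl⟩ := hA
  exact (hG.component_openArc a ha).exists_isEdgeChart hG.finite_vertexSet hcl

namespace IsEdgeChart

variable {A B : Set G} {γ γ' : ℝ → G} {g g' : G → ℝ}

theorem injOn (h : IsEdgeChart V A γ g) : InjOn γ (Ioo 0 1) := fun s hs t ht hst => by
  rw [← h.left_inv s hs, hst, h.left_inv t ht]

theorem zero_ne_one (h : IsEdgeChart V A γ g) (hG : IsTopGraph V) (hA : A ∈ graphEdges V) :
    γ 0 ≠ γ 1 := by
  intro h01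
  have hAV := disjoint_vertices_of_mem_graphEdges hA
  have hcirc : IsCircle (γ '' Icc 0 1) := by
    refine isCircle_image_Icc one_pos h.continuousOn ?_ h01
    intro s hs t ht hst
    rcases hs.1.eq_or_lt with rfl | hs0 <;> rcases ht.1.eq_or_lt with rfl | ht0
    · rfl
    · exact absurd (hst ▸ h.zero_mem) (hAV _ (h.mem_of_mem_Ioo t ⟨ht0, ht.2⟩))
    · exact absurd (hst ▸ h.zero_mem) (hAV _ (h.mem_of_mem_Ioo s ⟨hs0, hs.2⟩))
    · exact h.injOn ⟨hs0, hs.2⟩ ⟨ht0, ht.2⟩ hst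
  have hsub : γ '' Icc 0 1 ∩ V ⊆ {γ 0} := by
    rintro _ ⟨⟨t, ht, rfl⟩, hV⟩
    rcases ht.1.eq_or_lt with rfl | h0
    · rfl
    rcases ht.2.eq_or_lt with rfl | h1
    · exact h01.symm
    · exact absurd hV (hAV _ (h.mem_of_mem_Ioo t ⟨h0, h1⟩))
  have h1 := ncard_le_ncard hsub
  have h2 := hG.circle_vertices _ hcirc
  rw [ncard_singleton] at h1
  omega

theorem eq_of_endpoints_eq (h : IsEdgeChart V A γ g) (h' : IsEdgeChart V B γ' g')
    (hG : IsTopGraph V) (hA : A ∈ graphEdges V) (hB : B ∈ graphEdges V)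
    (h0 : γ 0 = γ' 0) (h1 : γ 1 = γ' 1) : A = B := by
  by_contra hAB
  have hAV := disjoint_vertices_of_mem_graphEdges hA
  have hBV := disjoint_vertices_of_mem_graphEdges hB
  have hdisj : ∀ s ∈ Ioo (0 : ℝ) 1, ∀ t ∈ Ioo (0 : ℝ) 1, γ s ≠ γ' t := fun s hs t ht hst =>
    hAB (eq_of_mem_graphEdges hA hB (h.mem_of_mem_Ioo s hs) (hst ▸ h'.mem_of_mem_Ioo t ht))
  have hne := h.zero_ne_one hG hA
  let δ : ℝ → G := fun t => if t ≤ 1 then γ t else γ' (2 - t)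
  have hδ1 : ∀ t ≤ 1, δ t = γ t := fun t ht => if_pos ht
  have hδ2 : ∀ t, 1 < t → δ t = γ' (2 - t) := fun t ht => if_neg (not_le.2 ht)
  have hδcont : ContinuousOn δ (Icc 0 2) := by
    have hc1 : ContinuousOn δ (Icc 0 1) := h.continuousOn.congr fun t ht => hδ1 t ht.2
    have hc2 : ContinuousOn δ (Icc 1 2) := by
      have : ContinuousOn (fun t : ℝ => γ' (2 - t)) (Icc 1 2) :=
        h'.continuousOn.comp (by fun_prop) fun t ht => ⟨by linarith [ht.2], by linarith [ht.1]⟩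
      refine this.congr fun t ht => ?_
      rcases ht.1.eq_or_lt with rfl | ht1
      · rw [hδ1 1 le_rfl, h1]; norm_num
      · exact hδ2 t ht1
    rw [← Icc_union_Icc_eq_Icc (zero_le_one' ℝ) one_le_two]
    exact hc1.union_of_isClosed hc2 isClosed_Icc isClosed_Icc
  have hcases : ∀ t ∈ Ico (0 : ℝ) 2, (t = 0 ∧ δ t = γ 0) ∨ (t = 1 ∧ δ t = γ 1) ∨
      (t ∈ Ioo 0 1 ∧ δ t = γ t) ∨ (2 - t ∈ Ioo (0 : ℝ) 1 ∧ δ t = γ' (2 - t)) := by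
    intro t ht
    rcases ht.1.eq_or_lt with rfl | ht0
    · exact Or.inl ⟨rfl, hδ1 _ zero_le_one⟩
    rcases lt_trichotomy t 1 with ht1 | rfl | ht1
    · exact Or.inr (Or.inr (Or.inl ⟨⟨ht0, ht1⟩, hδ1 t ht1.le⟩))
    · exact Or.inr (Or.inl ⟨rfl, hδ1 1 le_rfl⟩)
    · exact Or.inr (Or.inr (Or.inr ⟨⟨by linarith [ht.2], by linarith⟩, hδ2 t ht1⟩))
  have hγV : ∀ t ∈ Ioo (0 : ℝ) 1, γ t ∉ V := fun t ht => hAV _ (h.mem_of_mem_Ioo t ht)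
  have hγV' : ∀ t ∈ Ioo (0 : ℝ) 1, γ' t ∉ V := fun t ht => hBV _ (h'.mem_of_mem_Ioo t ht)
  have hend : δ 0 = δ 2 := by
    rw [hδ1 0 zero_le_one, hδ2 2 one_lt_two, sub_self, h0]
  have hcirc : IsCircle (δ '' Icc 0 2) := by
    refine isCircle_image_Icc two_pos hδcont ?_ hend
    intro s hs t ht hst
    have hz := h.zero_mem
    have ho := h.one_mem
    rcases hcases s hs with ⟨rfl, es⟩ | ⟨rfl, es⟩ | ⟨ms, es⟩ | ⟨ms, es⟩ <;>
    rcases hcases t ht with ⟨rfl, et⟩ | ⟨rfl, et⟩ | ⟨mt, et⟩ | ⟨mt, et⟩ <;>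
    replace hst := es.symm.trans (hst.trans et)
    · rfl
    · exact absurd hst hne
    · exact absurd (hst ▸ hz) (hγV _ mt)
    · exact absurd (hst ▸ hz) (hγV' _ mt)
    · exact absurd hst.symm hne
    · rfl
    · exact absurd (hst ▸ ho) (hγV _ mt)
    · exact absurd (hst ▸ ho) (hγV' _ mt)
    · exact absurd (hst ▸ hz) (hγV _ ms)
    · exact absurd (hst ▸ ho) (hγV _ ms)
    · exact h.injOn ms mt hst
    · exact absurd hst (hdisj _ ms _ mt)
    · exact absurd (hst ▸ hz) (hγV' _ ms)
    · exact absurd (hst ▸ ho) (hγV' _ ms)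
    · exact absurd hst.symm (hdisj _ mt _ ms)
    · linarith [h'.injOn ms mt hst]
  have hsub : δ '' Icc 0 2 ∩ V ⊆ {γ 0, γ 1} := by
    rintro _ ⟨⟨t, ht, rfl⟩, hV⟩
    rcases ht.2.eq_or_lt with rfl | ht2
    · left; rw [← hend]; exact hδ1 0 zero_le_one
    rcases hcases t ⟨ht.1, ht2⟩ with ⟨-, e⟩ | ⟨-, e⟩ | ⟨m, e⟩ | ⟨m, e⟩
    · exact Or.inl e
    · exact Or.inr e
    · exact absurd (e ▸ hV) (hγV _ m)
    · exact absurd (e ▸ hV) (hγV' _ m)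
  have h3 := ncard_le_ncard hsub (toFinite _)
  have h4 := hG.circle_vertices _ hcirc
  have h5 := ncard_insert_le (γ 0) {γ 1}
  rw [ncard_singleton] at h5
  omega

end IsEdgeChart

theorem IsTopGraph.finite_graphEdges (hG : IsTopGraph V) : (graphEdges V).Finite := by
  have := hG.nontrivial
  choose! γ g hγ using fun A (hA : A ∈ graphEdges V) => hG.exists_isEdgeChart hA
  refine Set.Finite.of_injOn (f := fun A => (γ A 0, γ A 1)) (t := V ×ˢ V) ?_ ?_
    (hG.finite_vertexSet.prod hG.finite_vertexSet)
  · exact fun A hA => ⟨(hγ A hA).zero_mem, (hγ A hA).one_mem⟩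
  · intro A hA B hB hAB
    simp only [Prod.mk.injEq] at hAB
    exact (hγ A hA).eq_of_endpoints_eq (hγ B hB) hG hA hB hAB.1 hAB.2

theorem mem_graphEdges_connectedComponentIn {x : G} (hx : x ∉ V) :
    connectedComponentIn Vᶜ x ∈ graphEdges V ∧ x ∈ connectedComponentIn Vᶜ x :=
  ⟨⟨x, hx, rfl⟩, mem_connectedComponentIn hx⟩

theorem IsTopGraph.isOpen_of_mem_graphEdges (hG : IsTopGraph V) {A : Set G}
    (hA : A ∈ graphEdges V) : IsOpen A := by
  have hclosed : IsClosed (V ∪ ⋃ B ∈ graphEdges V \ {A}, closure B) :=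
    hG.finite_vertexSet.isClosed.union
      ((hG.finite_graphEdges.sdiff).isClosed_biUnion fun _ _ => isClosed_closure)
  convert hclosed.isOpen_compl using 1
  ext x
  simp only [mem_compl_iff, mem_union, mem_iUnion, not_or, not_exists]
  constructor
  · intro hx
    refine ⟨disjoint_vertices_of_mem_graphEdges hA x hx, fun B hB hxB => ?_⟩
    rcases closure_subset_of_mem_graphEdges hB.1 hxB with h | h
    · exact hB.2 (eq_of_mem_graphEdges hB.1 hA h hx)
    · exact disjoint_vertices_of_mem_graphEdges hA x hx h
  · rintro ⟨hxV, hx⟩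
    obtain ⟨hB, hxB⟩ := mem_graphEdges_connectedComponentIn hxV
    by_contra hxA
    exact hx _ ⟨hB, fun h => hxA (h ▸ hxB)⟩ (subset_closure hxB)

theorem IsTopGraph.locallyConnectedSpace (hG : IsTopGraph V) : LocallyConnectedSpace G := by
  have := hG.nontrivial
  choose! γ g hγ using fun A (hA : A ∈ graphEdges V) => hG.exists_isEdgeChart hA
  have := hG.finite_graphEdges.to_subtype
  have := hG.finite_vertexSet.to_subtype
  refine locallyConnectedSpace_of_finite_cover_arcs (ι := graphEdges V ⊕ V)
    (Sum.elim (fun A => γ A) fun v _ => v) ?_ ?_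
  · rintro (A | v)
    · exact (hγ A A.2).continuousOn
    · exact continuousOn_const
  · intro x
    by_cases hx : x ∈ V
    · exact ⟨Sum.inr ⟨x, hx⟩, 0, ⟨le_rfl, zero_le_one⟩, rfl⟩
    · obtain ⟨hB, hxB⟩ := mem_graphEdges_connectedComponentIn hx
      exact ⟨Sum.inl ⟨_, hB⟩, _, Ioo_subset_Icc_self ((hγ _ hB).inv_mem x hxB),
        (hγ _ hB).right_inv x hxB⟩

theorem finite_closure_diff_interior_of_ordConnected {S : Set ℝ} (hS : S.OrdConnected) :
    (closure S \ interior S).Finite := by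
  by_contra hinf
  obtain ⟨T, hT, hcard⟩ := Set.Infinite.exists_subset_card_eq hinf 3
  let e := T.orderEmbOfFin hcard
  have he : ∀ i, e i ∈ closure S \ interior S := fun i => hT (T.orderEmbOfFin_mem hcard i)
  obtain ⟨a, ha, haS⟩ := _root_.mem_closure_iff.1 (he 0).1 (Iio (e 1)) isOpen_Iio
    (e.lt_iff_lt.2 (by decide))
  obtain ⟨b, hb, hbS⟩ := _root_.mem_closure_iff.1 (he 2).1 (Ioi (e 1)) isOpen_Ioi
    (e.lt_iff_lt.2 (by decide))
  exact (he 1).2 (mem_interior.2 ⟨Ioo a b, Ioo_subset_Icc_self.trans (hS.out haS hbS),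
    isOpen_Ioo, ha, hb⟩)

theorem IsEdgeChart.finite_frontier_inter {A K : Set G} {γ : ℝ → G} {g : G → ℝ}
    (h : IsEdgeChart V A γ g) (hA : IsOpen A) (hK : IsPreconnected K) :
    (frontier K ∩ A).Finite := by
  have hgopen : ∀ W : Set ℝ, IsOpen W → IsOpen (A ∩ g ⁻¹' W) := fun W hW =>
    h.continuousOn_inv.isOpen_inter_preimage hA hW
  let S : Set ℝ := g '' (K ∩ A)
  let T : Set ℝ := g '' (Kᶜ ∩ A)
  have hclos : ∀ M : Set G, ∀ x ∈ A, x ∈ closure M → g x ∈ closure (g '' (M ∩ A)) := by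
    intro M x hxA hx
    rw [_root_.mem_closure_iff] at hx ⊢
    intro W hW hxW
    obtain ⟨y, hy, hyM⟩ := hx _ (hgopen W hW) ⟨hxA, hxW⟩
    exact ⟨g y, hy.2, y, ⟨hyM, hy.1⟩, rfl⟩
  have hdisj : Disjoint S T := by
    rw [Set.disjoint_left]
    rintro _ ⟨x, ⟨hxK, hxA⟩, rfl⟩ ⟨y, ⟨hyK, hyA⟩, hxy⟩
    refine hyK ?_
    rwa [← h.right_inv y hyA, hxy, h.right_inv x hxA]
  have hST : S.OrdConnected ∨ T.OrdConnected := by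
    by_contra! hcon
    obtain ⟨hS, hT⟩ := hcon
    apply hS
    rw [ordConnected_def] at hT
    push Not at hT
    obtain ⟨a, ⟨x, hx, rfl⟩, c, ⟨z, hz, rfl⟩, hac⟩ := hT
    obtain ⟨b, hb, hbT⟩ := not_subset.1 hac
    have hxI := h.inv_mem x hx.2
    have hzI := h.inv_mem z hz.2
    have hsubI : Icc (g x) (g z) ⊆ Ioo 0 1 := fun t ht =>
      ⟨hxI.1.trans_le ht.1, ht.2.trans_lt hzI.2⟩
    have hbA := h.mem_of_mem_Ioo b (hsubI hb)
    have hgb := h.left_inv b (hsubI hb)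
    have hbK : γ b ∈ K := by
      by_contra hbK
      exact hbT ⟨γ b, ⟨hbK, hbA⟩, hgb⟩
    have hbx : g x ≠ b := fun e => hx.1 (by rwa [← h.right_inv x hx.2, e])
    have hbz : g z ≠ b := fun e => hz.1 (by rwa [← h.right_inv z hz.2, e])
    have hbo : b ∈ Ioo (g x) (g z) :=
      ⟨lt_of_le_of_ne hb.1 hbx, lt_of_le_of_ne hb.2 hbz.symm⟩
    have hcomp : IsClosed (γ '' Icc (g x) (g z)) :=
      (isCompact_Icc.image_of_continuousOn
        (h.continuousOn.mono (hsubI.trans Ioo_subset_Icc_self))).isClosed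
    have hKcov : K ⊆ (A ∩ g ⁻¹' Ioo (g x) (g z)) ∪ (γ '' Icc (g x) (g z))ᶜ := by
      intro y hy
      by_cases hyI : y ∈ γ '' Icc (g x) (g z)
      · left
        obtain ⟨t, ht, rfl⟩ := hyI
        have htA := h.mem_of_mem_Ioo t (hsubI ht)
        have htg := h.left_inv t (hsubI ht)
        refine ⟨htA, ?_⟩
        rw [mem_preimage, htg]
        refine ⟨lt_of_le_of_ne ht.1 fun e => hx.1 ?_, lt_of_le_of_ne ht.2 fun e => hz.1 ?_⟩
        · rwa [← h.right_inv x hx.2, e]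
        · rwa [← h.right_inv z hz.2, ← e]
      · exact Or.inr hyI
    have hKA : K ⊆ A := by
      by_contra hKA
      obtain ⟨y, hyK, hyA⟩ := not_subset.1 hKA
      obtain ⟨w, -, ⟨hwA, hwI⟩, hw⟩ := hK _ _ (hgopen _ isOpen_Ioo) hcomp.isOpen_compl hKcov
        ⟨γ b, hbK, hbA, by rwa [mem_preimage, hgb]⟩
        ⟨y, hyK, by
          rintro ⟨t, ht, rfl⟩
          exact hyA (h.mem_of_mem_Ioo t (hsubI ht))⟩
      exact hw ⟨g w, Ioo_subset_Icc_self hwI, h.right_inv w hwA⟩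
    have : S = g '' K := by simp only [S]; rw [inter_eq_left.2 hKA]
    rw [this]
    exact (hK.image g (h.continuousOn_inv.mono hKA)).ordConnected
  have hmem : ∀ x ∈ frontier K ∩ A, g x ∈ closure S ∧ g x ∈ closure T := by
    rintro x ⟨hx, hxA⟩
    rw [frontier_eq_closure_inter_closure] at hx
    exact ⟨hclos K x hxA hx.1, hclos Kᶜ x hxA hx.2⟩
  have hinj : InjOn g (frontier K ∩ A) := fun x hx y hy hxy => by
    rw [← h.right_inv x hx.2, hxy, h.right_inv y hy.2]
  have hint : ∀ P Q : Set ℝ, Disjoint P Q → ∀ t ∈ closure Q, t ∉ interior P :=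
    fun P Q hPQ t ht htP =>
      (Set.disjoint_left.1 ((hPQ.mono_left interior_subset).closure_right isOpen_interior)
        htP) ht
  rcases hST with hS | hT
  · refine Set.Finite.of_injOn ?_ hinj (finite_closure_diff_interior_of_ordConnected hS)
    exact fun x hx => ⟨(hmem x hx).1, hint S T hdisj _ (hmem x hx).2⟩
  · refine Set.Finite.of_injOn ?_ hinj (finite_closure_diff_interior_of_ordConnected hT)
    exact fun x hx => ⟨(hmem x hx).2, hint T S hdisj.symm _ (hmem x hx).1⟩

theorem IsTopGraph.finite_frontier (hG : IsTopGraph V) {K : Set G} (hK : IsPreconnected K) :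
    (frontier K).Finite := by
  have hfin : (V ∪ ⋃ A ∈ graphEdges V, frontier K ∩ A).Finite :=
    hG.finite_vertexSet.union (hG.finite_graphEdges.biUnion fun A hA => by
      obtain ⟨γ, g, h⟩ := hG.exists_isEdgeChart hA
      exact h.finite_frontier_inter (hG.isOpen_of_mem_graphEdges hA) hK)
  refine hfin.subset fun x hx => ?_
  by_cases hxV : x ∈ V
  · exact Or.inl hxV
  · obtain ⟨hA, hxA⟩ := mem_graphEdges_connectedComponentIn hxV
    exact Or.inr (mem_biUnion hA ⟨hx, hxA⟩)

end Graph

section Dynamics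

variable {G : Type*} {f : G → G} {K : Set G}

theorem iterate_mem_of_image_subset (hKinv : f '' K ⊆ K) {x : G} (hx : x ∈ K) (n : ℕ) :
    f^[n] x ∈ K :=
  (mapsTo_iff_image_subset.2 hKinv).iterate n hx

theorem subset_invOrbit (f : G → G) (K : Set G) : K ⊆ invOrbit f K := fun _ hx =>
  mem_iUnion.2 ⟨0, hx⟩

theorem mem_invOrbit_of_iterate {x : G} {n : ℕ} (hx : f^[n] x ∈ invOrbit f K) :
    x ∈ invOrbit f K := by
  obtain ⟨m, hm⟩ := mem_iUnion.1 hx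
  refine mem_iUnion.2 ⟨m + n, ?_⟩
  rwa [mem_preimage, iterate_add_apply]

theorem apply_mem_invOrbit (hKinv : f '' K ⊆ K) {x : G} (hx : x ∈ invOrbit f K) :
    f x ∈ invOrbit f K := by
  obtain ⟨m, hm⟩ := mem_iUnion.1 hx
  refine mem_iUnion.2 ⟨m, ?_⟩
  rw [mem_preimage, ← iterate_succ_apply, iterate_succ_apply']
  exact hKinv ⟨_, hm, rfl⟩

theorem invOrbit_eq_of_subset_of_subset {L : Set G} (hKL : K ⊆ L) (hL : L ⊆ invOrbit f K) :
    invOrbit f L = invOrbit f K := by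
  refine Subset.antisymm (fun x hx => ?_) (iUnion_mono fun i => preimage_mono hKL)
  obtain ⟨n, hn⟩ := mem_iUnion.1 hx
  exact mem_invOrbit_of_iterate (hL hn)

variable [MetricSpace G]

theorem eventually_iterate_mem_interior (hfr : (frontier K).Finite)
    (hKinv : f '' K ⊆ K) (hbd : frontier K ∩ periodicPts f = ∅) {x : G} (hx : x ∈ K) :
    ∀ᶠ n in atTop, f^[n] x ∈ interior K := by
  have hfin : {n : ℕ | f^[n] x ∈ frontier K}.Finite := by
    refine Set.Finite.of_injOn (f := fun n => f^[n] x) (fun n hn => hn) ?_ hfr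
    have key : ∀ m n : ℕ, m < n → f^[m] x ∈ frontier K → f^[m] x ≠ f^[n] x := by
      intro m n hmn hm heq
      refine notMem_empty (f^[m] x) (hbd ▸ ⟨hm, n - m, Nat.sub_pos_of_lt hmn, ?_⟩)
      rw [IsPeriodicPt, IsFixedPt, ← iterate_add_apply, Nat.sub_add_cancel hmn.le, heq]
    intro m hm n hn hmn
    rcases lt_trichotomy m n with h | h | h
    · exact absurd hmn (key m n h hm)
    · exact h
    · exact absurd hmn.symm (key n m h hn)
  have hev : ∀ᶠ n in atTop, f^[n] x ∉ frontier K := by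
    rw [← Nat.cofinite_eq_atTop]
    exact hfin.eventually_cofinite_notMem
  filter_upwards [hev] with n hn
  by_contra hni
  exact hn ⟨subset_closure (iterate_mem_of_image_subset hKinv hx n), hni⟩

theorem exists_open_superset_iterate_mem (hf : Continuous f) (hfr : (frontier K).Finite)
    (hKclosed : IsClosed K) (hKinv : f '' K ⊆ K) (hbd : frontier K ∩ periodicPts f = ∅) :
    ∃ (N : ℕ) (W : Set G), IsOpen W ∧ K ⊆ W ∧ ∀ x ∈ W, f^[N] x ∈ K := by
  have hev : ∀ᶠ n in atTop, ∀ x ∈ frontier K, f^[n] x ∈ interior K := by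
    rw [eventually_all_finite hfr]
    exact fun x hx => eventually_iterate_mem_interior hfr hKinv hbd
      (hKclosed.frontier_subset hx)
  obtain ⟨N, hN⟩ := hev.exists
  refine ⟨N, interior K ∪ f^[N] ⁻¹' interior K,
    isOpen_interior.union (isOpen_interior.preimage (hf.iterate N)), ?_, ?_⟩
  · intro x hx
    by_cases hxi : x ∈ interior K
    · exact Or.inl hxi
    · exact Or.inr (hN x ⟨subset_closure hx, hxi⟩)
  · rintro x (hx | hx)
    · exact iterate_mem_of_image_subset hKinv (interior_subset hx) N
    · exact interior_subset hx

theorem exists_nhds_iterate_image_subset (hf : Continuous f) (hfr : (frontier K).Finite)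
    (hKclosed : IsClosed K) (hKinv : f '' K ⊆ K) (hbd : frontier K ∩ periodicPts f = ∅)
    {y : G} (hy : y ∈ invOrbit f K) :
    ∃ m : ℕ, 1 ≤ m ∧ ∃ Z ∈ 𝓝 y, ∀ i : ℕ, m ≤ i → f^[i] '' Z ⊆ K := by
  obtain ⟨N, W, hW, hKW, hWK⟩ := exists_open_superset_iterate_mem hf hfr hKclosed hKinv hbd
  obtain ⟨j, hj⟩ := mem_iUnion.1 hy
  refine ⟨N + j + 1, by omega, f^[j] ⁻¹' W,
    (hf.iterate j).continuousAt.preimage_mem_nhds (hW.mem_nhds (hKW hj)), ?_⟩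
  rintro i hi _ ⟨z, hz, rfl⟩
  obtain ⟨k, rfl⟩ : ∃ k, i = k + (N + j) := ⟨i - (N + j), by omega⟩
  rw [iterate_add_apply, iterate_add_apply]
  exact iterate_mem_of_image_subset hKinv (hWK _ hz) k

theorem mainAbsorbed_subset (f : G → G) (K : Set G) : mainAbsorbed f K ⊆ invOrbit f K :=
  iUnion₂_subset fun _ _ => connectedComponentIn_subset _ _

theorem subset_mainAbsorbed (f : G → G) (K : Set G) : K ⊆ mainAbsorbed f K := fun _ hx =>
  mem_biUnion hx (mem_connectedComponentIn (subset_invOrbit f K hx))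

theorem mainAbsorbed_eq_connectedComponentIn (hK : IsPreconnected K) {x : G} (hx : x ∈ K) :
    mainAbsorbed f K = connectedComponentIn (invOrbit f K) x := by
  refine Subset.antisymm (iUnion₂_subset fun y hy => ?_) fun z hz => mem_biUnion hx hz
  rw [← connectedComponentIn_eq
    (hK.subset_connectedComponentIn hx (subset_invOrbit f K) hy)]

theorem image_mainAbsorbed_subset (hf : Continuous f) (hK : IsConnected K)
    (hKinv : f '' K ⊆ K) : f '' mainAbsorbed f K ⊆ mainAbsorbed f K := by
  obtain ⟨x, hx⟩ := hK.nonempty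
  have hfx : f x ∈ K := hKinv ⟨x, hx, rfl⟩
  have hpre : IsPreconnected (f '' mainAbsorbed f K) := by
    rw [mainAbsorbed_eq_connectedComponentIn hK.isPreconnected hx]
    exact isPreconnected_connectedComponentIn.image f hf.continuousOn
  have hsub : f '' mainAbsorbed f K ⊆ invOrbit f K := by
    rintro _ ⟨y, hy, rfl⟩
    exact apply_mem_invOrbit hKinv (mainAbsorbed_subset f K hy)
  have := hpre.subset_connectedComponentIn ⟨x, subset_mainAbsorbed f K hx, rfl⟩ hsub
  rwa [← mainAbsorbed_eq_connectedComponentIn hK.isPreconnected hfx] at this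

theorem omegaSet_subset_of_iterate_mem (hKclosed : IsClosed K) (hKinv : f '' K ⊆ K) {x : G}
    {n : ℕ} (hn : f^[n] x ∈ K) : omegaSet f x ⊆ K := by
  refine (iInter_subset _ n).trans (closure_minimal ?_ hKclosed)
  rintro _ ⟨m, rfl⟩
  simp only [iterate_add_apply]
  exact iterate_mem_of_image_subset hKinv hn m

theorem omegaSet_subset_omegaSet_iterate (f : G → G) (x : G) (n : ℕ) :
    omegaSet f x ⊆ omegaSet f (f^[n] x) := by
  refine subset_iInter fun i => (iInter_subset _ (i + n)).trans (closure_mono ?_)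
  rintro _ ⟨m, rfl⟩
  exact ⟨m, by simp only [← iterate_add_apply, add_assoc]⟩

theorem exists_iterate_mem_of_mem_omegaSet {x z : G} (hz : z ∈ omegaSet f x) {U : Set G}
    (hU : U ∈ 𝓝 z) : ∃ n, f^[n] x ∈ U := by
  obtain ⟨_, hmem, n, rfl⟩ := mem_closure_iff_nhds.1 (mem_iInter.1 hz 0) U hU
  exact ⟨_, hmem⟩

/-- If some `z ∈ ω(x)` has a neighborhood absorbed by `K`, then the orbit of `x` enters `K`. -/
theorem exists_iterate_mem_of_absorbed {x z : G} (hz : z ∈ omegaSet f x)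
    (habs : ∃ m : ℕ, 1 ≤ m ∧ ∃ Z ∈ 𝓝 z, ∀ i : ℕ, m ≤ i → f^[i] '' Z ⊆ K) :
    ∃ n, f^[n] x ∈ K := by
  obtain ⟨m, -, Z, hZ, hZK⟩ := habs
  obtain ⟨n, hn⟩ := exists_iterate_mem_of_mem_omegaSet hz hZ
  refine ⟨m + n, ?_⟩
  rw [iterate_add_apply]
  exact hZK m le_rfl ⟨_, hn, rfl⟩

theorem mem_of_mem_nonwanderingPts_of_absorbed (hf : Continuous f) (hKclosed : IsClosed K)
    {z : G} (hz : z ∈ nonwanderingPts f)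
    (habs : ∃ m : ℕ, 1 ≤ m ∧ ∃ Z ∈ 𝓝 z, ∀ i : ℕ, m ≤ i → f^[i] '' Z ⊆ K) : z ∈ K := by
  obtain ⟨m, -, Z, hZ, hZK⟩ := habs
  have hzZ := mem_of_mem_nhds hZ
  by_contra hzK
  have hnp : ∀ n : ℕ, 0 < n → f^[n] z ≠ z := by
    intro n hn hper
    refine hzK ?_
    have hfix : f^[n * m] z = z := IsPeriodicPt.mul_const (show IsPeriodicPt f n z from hper) m
    rw [← hfix]
    exact hZK _ (Nat.le_mul_of_pos_left m hn) ⟨z, hzZ, rfl⟩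
  have hU : ∀ᶠ x in 𝓝 z, x ∈ Z ∩ Kᶜ := (inter_mem hZ (hKclosed.isOpen_compl.mem_nhds hzK))
  have hsep : ∀ n ∈ Ico 1 m, ∃ U, IsOpen U ∧ z ∈ U ∧ Disjoint (f^[n] '' U) U := by
    intro n hn
    obtain ⟨A, B, hA, hB, hzA, hzB, hAB⟩ := t2_separation (hnp n hn.1)
    refine ⟨f^[n] ⁻¹' A ∩ B, (hA.preimage (hf.iterate n)).inter hB, ⟨hzA, hzB⟩, ?_⟩
    refine hAB.mono ?_ inter_subset_right
    rintro _ ⟨y, hy, rfl⟩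
    exact hy.1
  choose! U hUo hzU hUd using hsep
  have hUm : ∀ᶠ x in 𝓝 z, ∀ n ∈ Ico 1 m, x ∈ U n := by
    rw [eventually_all_finite (finite_Ico 1 m)]
    exact fun n hn => (hUo n hn).mem_nhds (hzU n hn)
  obtain ⟨O, hO, hOo, hzO⟩ := _root_.eventually_nhds_iff.1 (hU.and hUm)
  obtain ⟨n, hn, _, ⟨y, hy, rfl⟩, hyO⟩ := hz O hOo hzO
  rcases lt_or_ge n m with h | h
  · exact Set.disjoint_left.1 (hUd n ⟨hn, h⟩) ⟨y, (hO y hy).2 n ⟨hn, h⟩, rfl⟩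
      ((hO _ hyO).2 n ⟨hn, h⟩)
  · exact (hO _ hyO).1.2 (hZK n h ⟨y, (hO y hy).1.1, rfl⟩)

theorem nonwanderingPts_inter_subset :
    nonwanderingPts f ∩ K ⊆ nonwanderingPtsIn f K ∪ frontier K := by
  rintro z ⟨hz, hzK⟩
  by_cases hzi : z ∈ interior K
  · left
    refine ⟨hzK, fun U hU hzU => ?_⟩
    obtain ⟨n, hn, hne⟩ := hz (U ∩ interior K) (hU.inter isOpen_interior) ⟨hzU, hzi⟩
    have hsub : U ∩ interior K ⊆ U ∩ K := inter_subset_inter_right _ interior_subset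
    exact ⟨n, hn, hne.mono (inter_subset_inter (image_mono hsub) hsub)⟩
  · exact Or.inr ⟨subset_closure hzK, hzi⟩

end Dynamics

/-- for a graph map `f` and an `f`-invariant connected closed set `K`
with `∂_G K ∩ P(f) = ∅`, the five conclusions of Lemma 2.5. -/
theorem absorbed_set_of_connected_closed {G : Type*} [MetricSpace G] (V : Set G)
    (hG : IsTopGraph V) (f : G → G) (hf : Continuous f) (K : Set G)
    (hKconn : IsConnected K) (hKclosed : IsClosed K) (hKinv : f '' K ⊆ K)
    (hbd : frontier K ∩ Function.periodicPts f = ∅) :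
    (∃ L : Set G, K ⊆ L ∧ IsConnected L ∧ IsOpen L ∧ f '' L ⊆ L ∧
      invOrbit f L = invOrbit f K ∧ mainAbsorbed f L = mainAbsorbed f K) ∧
    (IsOpen (invOrbit f K) ∧ IsOpen (mainAbsorbed f K)) ∧
    (∀ y ∈ invOrbit f K, ∃ m : ℕ, 1 ≤ m ∧ ∃ Z ∈ nhds y,
      ∀ i : ℕ, m ≤ i → f^[i] '' Z ⊆ K) ∧
    (omegaLimitSet f ∩ invOrbit f K = omegaLimitSet f ∩ mainAbsorbed f K ∧
      omegaLimitSet f ∩ mainAbsorbed f K = omegaLimitSet f ∩ K ∧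
      omegaLimitSet f ∩ K = omegaLimitSetIn f K) ∧
    (nonwanderingPts f ∩ invOrbit f K = nonwanderingPts f ∩ mainAbsorbed f K ∧
      nonwanderingPts f ∩ mainAbsorbed f K = nonwanderingPts f ∩ K ∧
      nonwanderingPts f ∩ K ⊆ nonwanderingPtsIn f K ∪ frontier K) := by
  have := hG.locallyConnectedSpace
  have hfr : (frontier K).Finite := hG.finite_frontier hKconn.isPreconnected
  have habs := fun y (hy : y ∈ invOrbit f K) =>
    exists_nhds_iterate_image_subset hf hfr hKclosed hKinv hbd hy
  have hO : IsOpen (invOrbit f K) := by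
    refine isOpen_iff_mem_nhds.2 fun y hy => ?_
    obtain ⟨m, -, Z, hZ, hZK⟩ := habs y hy
    exact mem_of_superset hZ fun z hz => mem_iUnion.2 ⟨m, hZK m le_rfl ⟨z, hz, rfl⟩⟩
  obtain ⟨x₀, hx₀⟩ := hKconn.nonempty
  have hAbeq := mainAbsorbed_eq_connectedComponentIn (f := f) hKconn.isPreconnected hx₀
  have hAb : IsOpen (mainAbsorbed f K) := hAbeq ▸ hO.connectedComponentIn
  have hKAb := subset_mainAbsorbed f K
  have hAbO := mainAbsorbed_subset f K
  have hAbconn : IsConnected (mainAbsorbed f K) :=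
    ⟨⟨x₀, hKAb hx₀⟩, hAbeq ▸ isPreconnected_connectedComponentIn⟩
  have hinv : invOrbit f (mainAbsorbed f K) = invOrbit f K :=
    invOrbit_eq_of_subset_of_subset hKAb hAbO
  have hsandwich : ∀ S : Set G, S ∩ invOrbit f K ⊆ K →
      S ∩ invOrbit f K = S ∩ mainAbsorbed f K ∧ S ∩ mainAbsorbed f K = S ∩ K := by
    intro S hS
    have h : ∀ x ∈ S, x ∈ invOrbit f K → x ∈ K := fun x hx hx' => hS ⟨hx, hx'⟩
    exact ⟨Subset.antisymm (fun x hx => ⟨hx.1, hKAb (hS hx)⟩) (inter_subset_inter_right _ hAbO),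
      Subset.antisymm (fun x hx => ⟨hx.1, h x hx.1 (hAbO hx.2)⟩)
        (inter_subset_inter_right _ hKAb)⟩
  have hω : omegaLimitSet f ∩ invOrbit f K ⊆ K := by
    rintro z ⟨hz, hzO⟩
    obtain ⟨x, hx⟩ := mem_iUnion.1 hz
    obtain ⟨n, hn⟩ := exists_iterate_mem_of_absorbed hx (habs z hzO)
    exact omegaSet_subset_of_iterate_mem hKclosed hKinv hn hx
  have hΩ : nonwanderingPts f ∩ invOrbit f K ⊆ K := fun z hz =>
    mem_of_mem_nonwanderingPts_of_absorbed hf hKclosed hz.1 (habs z hz.2)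
  refine ⟨⟨mainAbsorbed f K, hKAb, hAbconn, hAb,
    image_mainAbsorbed_subset hf hKconn hKinv, hinv, ?_⟩, ⟨hO, hAb⟩, habs,
    ⟨(hsandwich _ hω).1, (hsandwich _ hω).2, ?_⟩,
    ⟨(hsandwich _ hΩ).1, (hsandwich _ hΩ).2, nonwanderingPts_inter_subset⟩⟩
  · rw [mainAbsorbed_eq_connectedComponentIn hAbconn.isPreconnected (hKAb hx₀), hinv, hAbeq]
  · ext z
    simp only [omegaLimitSet, omegaLimitSetIn, omegaSetIn, mem_inter_iff, mem_iUnion, mem_iInter,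
      exists_prop]
    constructor
    · rintro ⟨⟨x, hx⟩, hzK⟩
      obtain ⟨n, hn⟩ := exists_iterate_mem_of_absorbed hx (habs z (subset_invOrbit f K hzK))
      exact ⟨_, hn, fun i =>
        ⟨mem_iInter.1 (omegaSet_subset_omegaSet_iterate f x n hx) i, hzK⟩⟩
    · rintro ⟨x, -, hx⟩
      exact ⟨⟨x, mem_iInter.2 fun i => (hx i).1⟩, (hx 0).2⟩
end

section
/- Let f : G → G be a graph map and let K be a connected closed subset of G with f(K) ∩ K ≠ ∅. Let X = O(K,f) be the orbit of K under f. If cl(X) − X contains more than one point, then X ∩ P(f) ≠ ∅. -/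
open Set Function Filter Topology Metric

/-! ### Circles and continua -/

/-- A simple closed curve is a circle. -/
theorem isCircle_of_closed_curve {G : Type*} [TopologicalSpace G] [T2Space G] {γ : ℝ → G} {p : ℝ}
    (hp : 0 < p) (hc : ContinuousOn γ (Icc 0 p)) (h0 : γ 0 = γ p) (hi : InjOn γ (Ico 0 p)) :
    IsCircle (γ '' Ico 0 p) := by
  have : Fact (0 < p) := ⟨hp⟩
  set L : AddCircle p → G := AddCircle.liftIco p 0 γ with hL
  have hLc : Continuous L := AddCircle.liftIco_zero_continuous h0 hc
  have hsurj : ∀ z : AddCircle p, ∃ t ∈ Ico (0 : ℝ) p, (t : AddCircle p) = z := by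
    intro z
    have := AddCircle.coe_image_Ico_eq p (0 : ℝ)
    rw [zero_add] at this
    exact (this ▸ mem_univ z : z ∈ QuotientAddGroup.mk '' Ico (0 : ℝ) p)
  have hLt : ∀ t ∈ Ico (0 : ℝ) p, L t = γ t := fun t ht =>
    AddCircle.liftIco_zero_coe_apply ht
  have hLi : Injective L := by
    intro z w h
    obtain ⟨t, ht, rfl⟩ := hsurj z
    obtain ⟨u, hu, rfl⟩ := hsurj w
    rw [hLt t ht, hLt u hu] at h
    rw [hi ht hu h]
  have hr : range L = γ '' Ico 0 p := by
    ext x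
    constructor
    · rintro ⟨z, rfl⟩
      obtain ⟨t, ht, rfl⟩ := hsurj z
      exact ⟨t, ht, (hLt t ht).symm⟩
    · rintro ⟨t, ht, rfl⟩
      exact ⟨t, hLt t ht⟩
  rw [← hr]
  have e₁ : AddCircle p ≃ₜ range L :=
    (hLc.isClosedEmbedding hLi).isEmbedding.toHomeomorph
  have e₂ : AddCircle p ≃ₜ Metric.sphere (0 : ℂ) 1 := AddCircle.homeomorphCircle hp.ne'
  exact ⟨e₁.symm.trans e₂⟩

/-- Boundary bumping in a compact connected Hausdorff space. -/
theorem exists_mem_closure_connectedComponentIn {Z : Type*} [TopologicalSpace Z] [T2Space Z]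
    [CompactSpace Z] [PreconnectedSpace Z] {E : Set Z} (hE : IsOpen E) (hne : E ≠ univ) {x : Z}
    (hx : x ∈ E) : ∃ p ∈ closure (connectedComponentIn E x), p ∉ E := by
  by_contra! hcon
  obtain ⟨W, hWo, hCW, hWE⟩ := normal_exists_closure_subset isClosed_closure hE hcon
  have hxC : x ∈ connectedComponentIn E x := mem_connectedComponentIn hx
  have hxW : x ∈ closure W := subset_closure (hCW (subset_closure hxC))
  have : CompactSpace (closure W) := isCompact_iff_compactSpace.1 isClosed_closure.isCompact
  set x' : closure W := ⟨x, hxW⟩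
  have hcomp : connectedComponent x' ⊆ Subtype.val ⁻¹' W := by
    intro y hy
    have : (y : Z) ∈ connectedComponentIn (closure W) x := by
      rw [connectedComponentIn_eq_image hxW]
      exact ⟨y, hy, rfl⟩
    exact hCW (subset_closure (connectedComponentIn_mono x hWE this))
  rw [connectedComponent_eq_iInter_isClopen] at hcomp
  have hdir : Directed (· ⊇ ·) fun s : { s : Set (closure W) // IsClopen s ∧ x' ∈ s } => s.1 := by
    rintro ⟨s, hs, hxs⟩ ⟨t, ht, hxt⟩
    exact ⟨⟨s ∩ t, hs.inter ht, hxs, hxt⟩, inter_subset_left, inter_subset_right⟩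
  have : Nonempty { s : Set (closure W) // IsClopen s ∧ x' ∈ s } :=
    ⟨⟨univ, isClopen_univ, mem_univ _⟩⟩
  obtain ⟨⟨H, hH, hxH⟩, hHW⟩ := exists_subset_nhds_of_compactSpace hdir (fun s => s.2.1.isClosed)
    (U := Subtype.val ⁻¹' W)
    fun y hy => (hWo.preimage continuous_subtype_val).mem_nhds (hcomp hy)
  have hclosed : IsClosed (Subtype.val '' H : Set Z) :=
    isClosed_closure.isClosedEmbedding_subtypeVal.isClosedMap H hH.isClosed
  have hopen : IsOpen (Subtype.val '' H : Set Z) := by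
    obtain ⟨O, hO, rfl⟩ := isOpen_induced_iff.1 hH.isOpen
    have : Subtype.val '' (Subtype.val ⁻¹' O : Set (closure W)) = O ∩ W := by
      ext z
      constructor
      · rintro ⟨y, hy, rfl⟩
        exact ⟨hy, hHW hy⟩
      · rintro ⟨h1, h2⟩
        exact ⟨⟨z, subset_closure h2⟩, h1, rfl⟩
    rw [this]
    exact hO.inter hWo
  have huniv : (Subtype.val '' H : Set Z) = univ :=
    IsClopen.eq_univ ⟨hclosed, hopen⟩ ⟨x, x', hxH, rfl⟩
  apply hne
  rw [eq_univ_iff_forall]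
  intro z
  obtain ⟨y, hy, rfl⟩ := (huniv ▸ mem_univ z : z ∈ Subtype.val '' H)
  exact hWE (subset_closure (hHW hy))

/-- Boundary bumping for a continuum `K` and an open set meeting `K` but not containing it. -/
theorem IsConnected.exists_isPreconnected_bump {G : Type*} [TopologicalSpace G] [T2Space G]
    {K O : Set G} (hK : IsConnected K) (hKc : IsCompact K) (hO : IsOpen O) (hKO : ¬K ⊆ O)
    {x : G} (hxK : x ∈ K) (hxO : x ∈ O) :
    ∃ C ⊆ K ∩ O, IsPreconnected C ∧ x ∈ C ∧ ∃ p ∈ closure C, p ∈ K ∧ p ∉ O := by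
  have : CompactSpace K := isCompact_iff_compactSpace.1 hKc
  have : ConnectedSpace K := isConnected_iff_connectedSpace.1 hK
  have hne : (Subtype.val ⁻¹' O : Set K) ≠ univ := fun h =>
    hKO fun z hz => (h ▸ mem_univ (⟨z, hz⟩ : K) : (⟨z, hz⟩ : K) ∈ Subtype.val ⁻¹' O)
  obtain ⟨p, hp, hpO⟩ := exists_mem_closure_connectedComponentIn
    (hO.preimage continuous_subtype_val) hne (x := ⟨x, hxK⟩) hxO
  refine ⟨Subtype.val '' connectedComponentIn (Subtype.val ⁻¹' O) (⟨x, hxK⟩ : K), ?_,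
    isPreconnected_connectedComponentIn.image _ continuous_subtype_val.continuousOn,
    ⟨_, mem_connectedComponentIn hxO, rfl⟩, p, ?_, p.2, hpO⟩
  · rintro _ ⟨y, hy, rfl⟩
    exact ⟨y.2, (connectedComponentIn_subset (Subtype.val ⁻¹' O : Set K) _ hy :)⟩
  · exact image_closure_subset_closure_image continuous_subtype_val ⟨p, hp, rfl⟩

/-! ### Edges of a topological graph -/

/-- A free arc: an arc parametrized by `[0,1]` whose interior is open. -/
structure IsFreeArc {G : Type*} [TopologicalSpace G] (φ : ℝ → G) : Prop where
  continuousOn : ContinuousOn φ (Icc 0 1)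
  injOn : InjOn φ (Icc 0 1)
  isOpen : IsOpen (φ '' Ioo 0 1)

theorem exists_tendsto_of_eventually_mem {G α : Type*} [TopologicalSpace G] [T2Space G]
    {V : Set G} (hV : V.Finite) {l : Filter α} [l.NeBot] {φ : α → G}
    (hl : ∀ s ∈ l, ∃ t ∈ l, t ⊆ s ∧ IsPreconnected (φ '' t))
    (hφ : ∀ W, IsOpen W → V ⊆ W → ∀ᶠ t in l, φ t ∈ W) : ∃ v ∈ V, Tendsto φ l (𝓝 v) := by
  obtain ⟨U, hU, hd⟩ := hV.t2_separation
  have hsep : ∀ v ∈ V, ∀ O : Set G, O ⊆ U v → Disjoint O (⋃ w ∈ V \ {v}, U w) := by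
    intro v hv O hO
    rw [disjoint_iUnion₂_right]
    exact fun w hw => (hd hv hw.1 (Ne.symm hw.2)).mono_left hO
  have hopen : ∀ S : Set G, IsOpen (⋃ w ∈ S, U w) := fun S =>
    isOpen_biUnion fun w _ => (hU w).2
  have hcov : ∀ v ∈ V, ∀ O : Set G, v ∈ O → V ⊆ O ∪ ⋃ w ∈ V \ {v}, U w := by
    intro v hv O hvO w hw
    by_cases h : w = v
    · exact Or.inl (h ▸ hvO)
    · exact Or.inr (mem_biUnion (show w ∈ V \ {v} from ⟨hw, h⟩) (hU w).1)
  obtain ⟨T, hT, hTs, hTc⟩ := hl _ (hφ (⋃ w ∈ V, U w) (hopen V)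
    fun w hw => mem_biUnion hw (hU w).1)
  obtain ⟨t₀, ht₀⟩ := Filter.nonempty_of_mem hT
  obtain ⟨v, hv, hvt⟩ := mem_iUnion₂.1 (hTs ht₀)
  have hTU : φ '' T ⊆ U v := by
    refine IsPreconnected.subset_left_of_subset_union (hU v).2 (hopen (V \ {v}))
      (hsep v hv _ subset_rfl) ?_ ⟨φ t₀, ⟨t₀, ht₀, rfl⟩, hvt⟩ hTc
    rintro _ ⟨t, ht, rfl⟩
    obtain ⟨w, hw, hwt⟩ := mem_iUnion₂.1 (hTs ht)
    by_cases h : w = v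
    · exact Or.inl (h ▸ hwt)
    · exact Or.inr (mem_biUnion (show w ∈ V \ {v} from ⟨hw, h⟩) hwt)
  refine ⟨v, hv, fun O hO => ?_⟩
  obtain ⟨O', hO', hO'o, hvO'⟩ := mem_nhds_iff.1 hO
  change ∀ᶠ t in l, φ t ∈ O
  filter_upwards [hT, hφ _ ((hO'o.inter (hU v).2).union (hopen (V \ {v})))
    (hcov v hv _ ⟨hvO', (hU v).1⟩)] with t ht h
  rcases h with h | h
  · exact hO' h.1
  · exact ((hsep v hv _ subset_rfl).le_bot ⟨hTU ⟨t, ht, rfl⟩, h⟩).elim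

/-- Every component of the complement of the vertex set is the interior of a path joining two
vertices and injective in its interior. -/
theorem IsTopGraph.exists_edge {G : Type*} [MetricSpace G] {V : Set G} (hG : IsTopGraph V) {x : G}
    (hx : x ∈ Vᶜ) : ∃ φ : ℝ → G, ContinuousOn φ (Icc 0 1) ∧ InjOn φ (Ioo 0 1) ∧ φ 0 ∈ V ∧
      φ 1 ∈ V ∧ φ '' Ioo 0 1 = connectedComponentIn Vᶜ x := by
  have := hG.compact
  obtain ⟨h⟩ := hG.component_openArc x hx
  set A := connectedComponentIn Vᶜ x with hA
  have hAc : closure A ∩ Vᶜ ⊆ A := by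
    refine IsPreconnected.subset_connectedComponentIn
      (isPreconnected_connectedComponentIn.subset_closure (s := A) (fun y hy =>
        ⟨subset_closure hy, connectedComponentIn_subset _ _ hy⟩) inter_subset_left)
      ⟨subset_closure (mem_connectedComponentIn hx), hx⟩ inter_subset_right
  set φ : ℝ → G := fun t => if ht : t ∈ Ioo (0 : ℝ) 1 then (h.symm ⟨t, ht⟩ : G) else x with hφ
  have hφt : ∀ t (ht : t ∈ Ioo (0 : ℝ) 1), φ t = h.symm ⟨t, ht⟩ := fun t ht => dif_pos ht
  have hcont : ContinuousOn φ (Ioo 0 1) := by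
    rw [continuousOn_iff_continuous_domRestrict]
    have : (Ioo (0 : ℝ) 1).domRestrict φ = fun t => (h.symm t : G) := by
      ext t
      exact hφt t t.2
    rw [this]
    exact continuous_subtype_val.comp h.symm.continuous
  have hinj : InjOn φ (Ioo 0 1) := by
    intro t ht u hu htu
    rw [hφt t ht, hφt u hu] at htu
    exact congrArg Subtype.val (h.symm.injective (Subtype.val_injective htu))
  have him : φ '' Ioo 0 1 = A := by
    ext y
    constructor
    · rintro ⟨t, ht, rfl⟩
      rw [hφt t ht]
      exact Subtype.coe_prop _
    · intro hy
      refine ⟨h ⟨y, hy⟩, (h ⟨y, hy⟩).2, ?_⟩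
      rw [hφt _ (h ⟨y, hy⟩).2]
      simp
  have key : ∀ W, IsOpen W → V ⊆ W → IsClosed {t : ℝ | t ∈ Ioo (0 : ℝ) 1 ∧ φ t ∉ W} := by
    intro W hW hVW
    have hc : IsCompact (A \ W) := by
      have : A \ W = closure A \ W := by
        refine subset_antisymm (fun y hy => ⟨subset_closure hy.1, hy.2⟩) fun y hy =>
          ⟨hAc ⟨hy.1, fun hyV => hy.2 (hVW hyV)⟩, hy.2⟩
      rw [this]
      exact isClosed_closure.isCompact.diff hW
    have hc' : IsCompact (Subtype.val ⁻¹' (A \ W) : Set A) := by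
      rw [Topology.IsEmbedding.subtypeVal.isInducing.isCompact_preimage_iff]
      · exact hc
      · rw [Subtype.range_coe]
        exact sdiff_subset
    have : {t : ℝ | t ∈ Ioo (0 : ℝ) 1 ∧ φ t ∉ W} =
        (fun a : A => (h a : ℝ)) '' (Subtype.val ⁻¹' (A \ W)) := by
      ext t
      constructor
      · rintro ⟨ht, htW⟩
        refine ⟨h.symm ⟨t, ht⟩, ⟨Subtype.coe_prop _, ?_⟩, by simp⟩
        rwa [← hφt t ht]
      · rintro ⟨a, ha, rfl⟩
        refine ⟨(h a).2, ?_⟩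
        rw [hφt _ (h a).2]
        simpa using ha.2
    rw [this]
    exact (hc'.image (continuous_subtype_val.comp h.continuous)).isClosed
  obtain ⟨v, hv, hv'⟩ := exists_tendsto_of_eventually_mem hG.finite_vertexSet (l := 𝓝[>] (0 : ℝ))
    (φ := φ) (fun s hs => by
      obtain ⟨u, hu, hus⟩ := mem_nhdsGT_iff_exists_Ioo_subset.1 hs
      have hu0 : (0 : ℝ) < u := hu
      refine ⟨Ioo 0 (min u 1), Ioo_mem_nhdsGT (lt_min hu0 one_pos),
        (Ioo_subset_Ioo_right (min_le_left _ _)).trans hus, isPreconnected_Ioo.image _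
        (hcont.mono (Ioo_subset_Ioo_right (min_le_right _ _)))⟩)
    (fun W hW hVW => by
      have h0 : ∀ᶠ t in 𝓝[>] (0 : ℝ), t ∉ {t : ℝ | t ∈ Ioo (0 : ℝ) 1 ∧ φ t ∉ W} :=
        nhdsWithin_le_nhds ((key W hW hVW).isOpen_compl.mem_nhds (fun h => lt_irrefl _ h.1.1))
      filter_upwards [h0, Ioo_mem_nhdsGT (zero_lt_one' ℝ)] with t ht ht1
      by_contra hcon
      exact ht ⟨ht1, hcon⟩)
  obtain ⟨w, hw, hw'⟩ := exists_tendsto_of_eventually_mem hG.finite_vertexSet (l := 𝓝[<] (1 : ℝ))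
    (φ := φ) (fun s hs => by
      obtain ⟨u, hu, hus⟩ := mem_nhdsLT_iff_exists_Ioo_subset.1 hs
      have hu0 : u < (1 : ℝ) := hu
      refine ⟨Ioo (max u 0) 1, Ioo_mem_nhdsLT (max_lt hu0 one_pos),
        (Ioo_subset_Ioo_left (le_max_left _ _)).trans hus, isPreconnected_Ioo.image _
        (hcont.mono (Ioo_subset_Ioo_left (le_max_right _ _)))⟩)
    (fun W hW hVW => by
      have h0 : ∀ᶠ t in 𝓝[<] (1 : ℝ), t ∉ {t : ℝ | t ∈ Ioo (0 : ℝ) 1 ∧ φ t ∉ W} :=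
        nhdsWithin_le_nhds ((key W hW hVW).isOpen_compl.mem_nhds (fun h => lt_irrefl _ h.1.2))
      filter_upwards [h0, Ioo_mem_nhdsLT (zero_lt_one' ℝ)] with t ht ht1
      by_contra hcon
      exact ht ⟨ht1, hcon⟩)
  have heq : EqOn (extendFrom (Ioo 0 1) φ) φ (Ioo 0 1) := fun t ht =>
    extendFrom_extends hcont t ht
  refine ⟨extendFrom (Ioo 0 1) φ, continuousOn_Icc_extendFrom_Ioo hcont hv' hw',
    hinj.congr heq.symm, ?_, ?_, ?_⟩
  · rwa [eq_lim_at_left_extendFrom_Ioo one_pos hv']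
  · rwa [eq_lim_at_right_extendFrom_Ioo one_pos hw']
  · rw [heq.image_eq, him]

theorem mem_Icc_cases {t : ℝ} (ht : t ∈ Icc (0 : ℝ) 1) : t = 0 ∨ t = 1 ∨ t ∈ Ioo (0 : ℝ) 1 := by
  rcases ht.1.eq_or_lt with h | h
  · exact Or.inl h.symm
  · rcases ht.2.eq_or_lt with h₁ | h₁
    · exact Or.inr (Or.inl h₁)
    · exact Or.inr (Or.inr ⟨h, h₁⟩)

/-- A closed edge: an arc joining two points of `V`, with interior disjoint from `V`. -/
structure IsEdge {G : Type*} [TopologicalSpace G] (V : Set G) (φ : ℝ → G) : Prop where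
  continuousOn : ContinuousOn φ (Icc 0 1)
  injOn : InjOn φ (Icc 0 1)
  zero_mem : φ 0 ∈ V
  one_mem : φ 1 ∈ V
  notMem : ∀ t ∈ Ioo (0 : ℝ) 1, φ t ∉ V

theorem IsTopGraph.exists_isEdge {G : Type*} [MetricSpace G] {V : Set G} (hG : IsTopGraph V) {x : G}
    (hx : x ∈ Vᶜ) : ∃ φ : ℝ → G, IsEdge V φ ∧ φ '' Ioo 0 1 = connectedComponentIn Vᶜ x := by
  obtain ⟨φ, hc, hi, h0, h1, him⟩ := hG.exists_edge hx
  have hV : ∀ t ∈ Ioo (0 : ℝ) 1, φ t ∉ V := fun t ht =>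
    connectedComponentIn_subset Vᶜ x (him ▸ mem_image_of_mem φ ht)
  have hne0 : ∀ t ∈ Ioo (0 : ℝ) 1, φ t ≠ φ 0 := fun t ht h => hV t ht (h ▸ h0)
  have hne1 : ∀ t ∈ Ioo (0 : ℝ) 1, φ t ≠ φ 1 := fun t ht h => hV t ht (h ▸ h1)
  have h01 : φ 0 ≠ φ 1 := by
    intro h01
    have hinj : InjOn φ (Ico 0 1) := by
      intro t ht u hu htu
      rcases ht.1.eq_or_lt with rfl | ht0 <;> rcases hu.1.eq_or_lt with rfl | hu0
      · rfl
      · exact (hne0 u ⟨hu0, hu.2⟩ htu.symm).elim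
      · exact (hne0 t ⟨ht0, ht.2⟩ htu).elim
      · exact hi ⟨ht0, ht.2⟩ ⟨hu0, hu.2⟩ htu
    have h3 := hG.circle_vertices _ (isCircle_of_closed_curve one_pos hc h01 hinj)
    have hsub : φ '' Ico 0 1 ∩ V ⊆ {φ 0} := by
      rintro _ ⟨⟨t, ht, rfl⟩, htV⟩
      rcases ht.1.eq_or_lt with rfl | ht0
      · rfl
      · exact (hV t ⟨ht0, ht.2⟩ htV).elim
    have := ncard_le_ncard hsub
    rw [ncard_singleton] at this
    omega
  refine ⟨φ, ⟨hc, ?_, h0, h1, hV⟩, him⟩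
  intro t ht u hu htu
  rcases mem_Icc_cases ht with rfl | rfl | ht' <;> rcases mem_Icc_cases hu with rfl | rfl | hu'
  · rfl
  · exact (h01 htu).elim
  · exact (hne0 u hu' htu.symm).elim
  · exact (h01 htu.symm).elim
  · rfl
  · exact (hne1 u hu' htu.symm).elim
  · exact (hne0 t ht' htu).elim
  · exact (hne1 t ht' htu).elim
  · exact hi ht' hu' htu

/-- Two edges with the same ends and disjoint interiors form a circle. -/
theorem IsEdge.isCircle_union {G : Type*} [TopologicalSpace G] [T2Space G] {V : Set G}
    {φ ψ : ℝ → G} (hφ : IsEdge V φ) (hψ : IsEdge V ψ) (h0 : φ 0 = ψ 0) (h1 : φ 1 = ψ 1)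
    (hd : Disjoint (φ '' Ioo 0 1) (ψ '' Ioo 0 1)) :
    IsCircle (φ '' Icc 0 1 ∪ ψ '' Ioo 0 1) := by
  set γ : ℝ → G := fun t => if t ≤ 1 then φ t else ψ (2 - t) with hγ
  have hγ1 : ∀ t, t ≤ 1 → γ t = φ t := fun t ht => if_pos ht
  have hγ2 : ∀ t, 1 < t → γ t = ψ (2 - t) := fun t ht => if_neg ht.not_ge
  have hγ2' : EqOn γ (fun t => ψ (2 - t)) (Icc 1 2) := by
    intro t ht
    rcases ht.1.eq_or_lt with rfl | h
    · rw [hγ1 1 le_rfl, h1]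
      norm_num
    · exact hγ2 t h
  have hc : ContinuousOn γ (Icc 0 2) := by
    have : Icc (0 : ℝ) 2 = Icc 0 1 ∪ Icc 1 2 := by
      rw [Icc_union_Icc_eq_Icc] <;> norm_num
    rw [this]
    refine ContinuousOn.union_of_isClosed ?_ ?_ isClosed_Icc isClosed_Icc
    · exact hφ.continuousOn.congr fun t ht => hγ1 t ht.2
    · refine ContinuousOn.congr (hψ.continuousOn.comp (by fun_prop) ?_) hγ2'
      intro t ht
      constructor <;> linarith [ht.1, ht.2]
  have hdisj : ∀ t ∈ Icc (0 : ℝ) 1, ∀ u ∈ Ioo (0 : ℝ) 1, φ t ≠ ψ u := by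
    intro t ht u hu htu
    rcases mem_Icc_cases ht with rfl | rfl | ht'
    · exact hψ.notMem u hu (htu ▸ hφ.zero_mem)
    · exact hψ.notMem u hu (htu ▸ hφ.one_mem)
    · exact hd.le_bot ⟨⟨t, ht', rfl⟩, ⟨u, hu, htu.symm⟩⟩
  have hi : InjOn γ (Ico 0 2) := by
    intro t ht u hu htu
    rcases le_or_gt t 1 with h | h <;> rcases le_or_gt u 1 with h' | h'
    · rw [hγ1 t h, hγ1 u h'] at htu
      exact hφ.injOn ⟨ht.1, h⟩ ⟨hu.1, h'⟩ htu
    · rw [hγ1 t h, hγ2 u h'] at htu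
      exact (hdisj t ⟨ht.1, h⟩ _ ⟨by linarith [hu.2], by linarith⟩ htu).elim
    · rw [hγ2 t h, hγ1 u h'] at htu
      exact (hdisj u ⟨hu.1, h'⟩ _ ⟨by linarith [ht.2], by linarith⟩ htu.symm).elim
    · rw [hγ2 t h, hγ2 u h'] at htu
      have := hψ.injOn ⟨by linarith [ht.2], by linarith⟩ ⟨by linarith [hu.2], by linarith⟩ htu
      linarith
  have him : γ '' Ico 0 2 = φ '' Icc 0 1 ∪ ψ '' Ioo 0 1 := by
    ext x
    constructor
    · rintro ⟨t, ht, rfl⟩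
      rcases le_or_gt t 1 with h | h
      · exact Or.inl ⟨t, ⟨ht.1, h⟩, (hγ1 t h).symm⟩
      · exact Or.inr ⟨2 - t, ⟨by linarith [ht.2], by linarith⟩, (hγ2 t h).symm⟩
    · rintro (⟨t, ht, rfl⟩ | ⟨t, ht, rfl⟩)
      · exact ⟨t, ⟨ht.1, by linarith [ht.2]⟩, hγ1 t ht.2⟩
      · refine ⟨2 - t, ⟨by linarith [ht.2], by linarith [ht.1]⟩, ?_⟩
        rw [hγ2 _ (by linarith [ht.2])]
        congr 1
        ring
  rw [← him]
  refine isCircle_of_closed_curve two_pos hc ?_ hi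
  rw [hγ1 0 zero_le_one, hγ2 2 one_lt_two, h0]
  norm_num

/-- A finite family of free arcs whose interiors are pairwise disjoint, disjoint from the finite
set `V` and cover the complement of `V`, and whose ends lie in `V`. -/
structure IsEdgeSystem {G ι : Type*} [TopologicalSpace G] (V : Set G) (φ : ι → ℝ → G) : Prop where
  finite : V.Finite
  isEdge : ∀ i, IsEdge V (φ i)
  isFreeArc : ∀ i, IsFreeArc (φ i)
  disjoint : ∀ i j, i ≠ j → Disjoint (φ i '' Ioo 0 1) (φ j '' Ioo 0 1)
  cover : ∀ x ∉ V, ∃ i, x ∈ φ i '' Ioo 0 1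

theorem connectedComponentIn_eq_of_not_disjoint {G : Type*} [TopologicalSpace G] {F : Set G}
    {x y : G} (h : ¬Disjoint (connectedComponentIn F x) (connectedComponentIn F y)) :
    connectedComponentIn F x = connectedComponentIn F y := by
  obtain ⟨z, hzx, hzy⟩ := not_disjoint_iff.1 h
  rw [connectedComponentIn_eq hzx, connectedComponentIn_eq hzy]

theorem IsTopGraph.exists_isEdgeSystem.{u} {G : Type u} [MetricSpace G] {V : Set G}
    (hG : IsTopGraph V) :
    ∃ (ι : Type u) (_ : Finite ι) (φ : ι → ℝ → G), IsEdgeSystem V φ := by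
  choose! φ hφ him using fun x hx => hG.exists_isEdge (x := x) hx
  set S : Set (Set G) := connectedComponentIn Vᶜ '' Vᶜ with hS
  have hrep : ∀ c : S, ∃ x ∈ Vᶜ, connectedComponentIn Vᶜ x = c := fun c => c.2
  choose r hr hrc using hrep
  have hdisj : ∀ c d : S, c ≠ d → Disjoint (φ (r c) '' Ioo 0 1) (φ (r d) '' Ioo 0 1) := by
    intro c d hcd
    rw [him _ (hr c), him _ (hr d)]
    by_contra h
    apply hcd
    ext1
    rw [← hrc c, ← hrc d]
    exact connectedComponentIn_eq_of_not_disjoint h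
  have hVf := hG.finite_vertexSet
  have : Finite V := hVf
  have hfin : Finite S := by
    refine Finite.of_injective (β := V × V) (fun c =>
      (⟨φ (r c) 0, (hφ _ (hr c)).zero_mem⟩, ⟨φ (r c) 1, (hφ _ (hr c)).one_mem⟩)) ?_
    intro c d hcd
    simp only [Prod.mk.injEq, Subtype.mk.injEq] at hcd
    by_contra hne
    have h3 := hG.circle_vertices _ ((hφ _ (hr c)).isCircle_union (hφ _ (hr d)) hcd.1 hcd.2
      (hdisj c d hne))
    have hsub : (φ (r c) '' Icc 0 1 ∪ φ (r d) '' Ioo 0 1) ∩ V ⊆ {φ (r c) 0, φ (r c) 1} := by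
      rintro _ ⟨⟨t, ht, rfl⟩ | ⟨t, ht, rfl⟩, htV⟩
      · rcases mem_Icc_cases ht with rfl | rfl | ht'
        · exact Or.inl rfl
        · exact Or.inr rfl
        · exact ((hφ _ (hr c)).notMem t ht' htV).elim
      · exact ((hφ _ (hr d)).notMem t ht htV).elim
    have h1 := ncard_le_ncard hsub (by simp)
    have h2 := ncard_insert_le (φ (r c) 0) {φ (r c) 1}
    rw [ncard_singleton] at h2
    omega
  have hcover : ∀ x ∉ V, ∃ c : S, x ∈ φ (r c) '' Ioo 0 1 := by
    intro x hx
    refine ⟨⟨connectedComponentIn Vᶜ x, x, hx, rfl⟩, ?_⟩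
    rw [him _ (hr _), hrc]
    exact mem_connectedComponentIn hx
  have hopen : ∀ c : S, IsOpen (φ (r c) '' Ioo 0 1) := by
    intro c
    have : φ (r c) '' Ioo 0 1 = (V ∪ ⋃ d : {d : S // d ≠ c}, φ (r d) '' Icc 0 1)ᶜ := by
      ext x
      constructor
      · rintro ⟨t, ht, rfl⟩ (h | h)
        · exact (hφ _ (hr c)).notMem t ht h
        · obtain ⟨⟨d, hd⟩, u, hu, hut⟩ := mem_iUnion.1 h
          rcases mem_Icc_cases hu with rfl | rfl | hu'
          · exact (hφ _ (hr c)).notMem t ht (hut ▸ (hφ _ (hr d)).zero_mem)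
          · exact (hφ _ (hr c)).notMem t ht (hut ▸ (hφ _ (hr d)).one_mem)
          · exact (hdisj d c hd).le_bot ⟨⟨u, hu', hut⟩, ⟨t, ht, rfl⟩⟩
      · intro h
        rw [compl_union] at h
        obtain ⟨d, hd⟩ := hcover x h.1
        by_cases hdc : d = c
        · exact hdc ▸ hd
        · exact (h.2 (mem_iUnion.2 ⟨⟨d, hdc⟩, image_mono Ioo_subset_Icc_self hd⟩)).elim
    rw [this, isOpen_compl_iff]
    exact hVf.isClosed.union (isClosed_iUnion_of_finite fun d =>
      (isCompact_Icc.image_of_continuousOn (hφ _ (hr d)).continuousOn).isClosed)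
  exact ⟨S, hfin, fun c => φ (r c), hVf, fun c => hφ _ (hr c), fun c =>
    ⟨(hφ _ (hr c)).continuousOn, (hφ _ (hr c)).injOn, hopen c⟩, hdisj, hcover⟩

/-! ### Free arcs and ends of connected subsets -/

namespace IsFreeArc

variable {G : Type*} [TopologicalSpace G] {φ : ℝ → G}

theorem exists_image_Ioo_subset (h : IsFreeArc φ) {U : Set G} (hU : U ∈ 𝓝 (φ 0)) :
    ∃ s ∈ Ioc (0 : ℝ) 1, φ '' Ioo 0 s ⊆ U := by
  have hc : Tendsto φ (𝓝[>] 0) (𝓝 (φ 0)) :=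
    (h.continuousOn 0 ⟨le_rfl, zero_le_one⟩).mono_left
      (nhdsWithin_le_iff.2 (Icc_mem_nhdsGT one_pos))
  obtain ⟨s, hs, hsU⟩ := mem_nhdsGT_iff_exists_Ioo_subset.1 (hc hU)
  refine ⟨min s 1, ⟨lt_min hs one_pos, min_le_right _ _⟩, ?_⟩
  rintro _ ⟨t, ht, rfl⟩
  exact hsU ⟨ht.1, ht.2.trans_le (min_le_left _ _)⟩

variable [T2Space G]

theorem isClosed_image (h : IsFreeArc φ) {a b : ℝ} (ha : 0 ≤ a) (hb : b ≤ 1) :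
    IsClosed (φ '' Icc a b) :=
  (isCompact_Icc.image_of_continuousOn (h.continuousOn.mono (Icc_subset_Icc ha hb))).isClosed

theorem isOpen_image (h : IsFreeArc φ) {a b : ℝ} (ha : 0 ≤ a) (hb : b ≤ 1) :
    IsOpen (φ '' Ioo a b) := by
  rcases le_or_gt b a with hab | hab
  · simp [Ioo_eq_empty hab.not_gt]
  have : φ '' Ioo a b = φ '' Ioo 0 1 ∩ (φ '' Icc 0 a ∪ φ '' Icc b 1)ᶜ := by
    ext x
    constructor
    · rintro ⟨t, ht, rfl⟩
      have ht01 : t ∈ Icc (0 : ℝ) 1 := ⟨ha.trans ht.1.le, ht.2.le.trans hb⟩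
      refine ⟨⟨t, ⟨ha.trans_lt ht.1, ht.2.trans_le hb⟩, rfl⟩, ?_⟩
      rintro (⟨u, hu, hut⟩ | ⟨u, hu, hut⟩)
      · have := h.injOn ⟨hu.1, hu.2.trans (hab.le.trans hb)⟩ ht01 hut
        linarith [hu.2, ht.1]
      · have := h.injOn ⟨ha.trans (hab.le.trans hu.1), hu.2⟩ ht01 hut
        linarith [hu.1, ht.2]
    · rintro ⟨⟨t, ht, rfl⟩, hn⟩
      rw [compl_union] at hn
      refine ⟨t, ⟨?_, ?_⟩, rfl⟩
      · by_contra! hta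
        exact hn.1 ⟨t, ⟨ht.1.le, hta⟩, rfl⟩
      · by_contra! htb
        exact hn.2 ⟨t, ⟨htb, ht.2.le⟩, rfl⟩
  rw [this]
  exact h.isOpen.inter
    ((h.isClosed_image le_rfl (hab.le.trans hb)).union
      (h.isClosed_image (ha.trans hab.le) le_rfl)).isOpen_compl

theorem comp_affine (h : IsFreeArc φ) {a b : ℝ} (ha : a ∈ Icc (0 : ℝ) 1) (hb : b ∈ Icc (0 : ℝ) 1)
    (hab : a ≠ b) : IsFreeArc fun t => φ (a + t * (b - a)) := by
  have hm : MapsTo (fun t => a + t * (b - a)) (Icc (0 : ℝ) 1) (Icc 0 1) := by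
    intro t ht
    have := (convex_Icc (0 : ℝ) 1).add_smul_sub_mem ha hb ht
    simpa using this
  refine ⟨h.continuousOn.comp (by fun_prop) hm, ?_, ?_⟩
  · intro t ht u hu htu
    have := h.injOn (hm ht) (hm hu) htu
    have h' : (t - u) * (b - a) = 0 := by linarith
    rcases mul_eq_zero.1 h' with h'' | h''
    · linarith
    · exact (hab (by linarith)).elim
  · have : (fun t => φ (a + t * (b - a))) '' Ioo 0 1 = φ '' Ioo (min a b) (max a b) := by
      rw [← openSegment_eq_Ioo' hab, openSegment_eq_image', image_image]
      simp
    rw [this]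
    exact h.isOpen_image (le_min ha.1 hb.1) (max_le ha.2 hb.2)

/-- A connected set that meets an open subarc whose ends it avoids is contained in it. -/
theorem subset_image_Ioo (h : IsFreeArc φ) {U : Set G} (hU : IsPreconnected U) {a b t : ℝ}
    (ha : 0 ≤ a) (hb : b ≤ 1) (haU : φ a ∉ U) (hbU : φ b ∉ U) (ht : t ∈ Ioo a b) (htU : φ t ∈ U) :
    U ⊆ φ '' Ioo a b := by
  refine IsPreconnected.subset_left_of_subset_union (h.isOpen_image ha hb)
    (h.isClosed_image ha hb).isOpen_compl
    (disjoint_compl_right.mono_left (image_mono Ioo_subset_Icc_self)) ?_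
    ⟨φ t, htU, t, ht, rfl⟩ hU
  intro x hx
  by_cases hxI : x ∈ φ '' Icc a b
  · obtain ⟨u, hu, rfl⟩ := hxI
    left
    refine ⟨u, ⟨lt_of_le_of_ne hu.1 ?_, lt_of_le_of_ne hu.2 ?_⟩, rfl⟩
    · rintro rfl
      exact haU hx
    · rintro rfl
      exact hbU hx
  · exact Or.inr hxI

theorem not_three_mem_closure_diff (h : IsFreeArc φ) {U : Set G} (hU : IsPreconnected U)
    {a b c : ℝ} (ha : 0 < a) (hab : a < b) (hbc : b < c) (hc : c < 1)
    (haU : φ a ∈ closure U \ U) (hbU : φ b ∈ closure U \ U) (hcU : φ c ∈ closure U \ U) :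
    False := by
  obtain ⟨_, ⟨t, ht, rfl⟩, htU⟩ := mem_closure_iff.1 hbU.1 (φ '' Ioo a c)
    (h.isOpen_image ha.le hc.le) ⟨b, ⟨hab, hbc⟩, rfl⟩
  have hcl : ∀ u v, 0 ≤ u → v ≤ 1 → U ⊆ φ '' Ioo u v → closure U ⊆ φ '' Icc u v :=
    fun u v hu hv hUuv => closure_minimal (hUuv.trans (image_mono Ioo_subset_Icc_self))
      (h.isClosed_image hu hv)
  rcases lt_trichotomy t b with htb | rfl | htb
  · obtain ⟨u, hu, huc⟩ := hcl a b ha.le (hbc.trans hc).le (h.subset_image_Ioo hU ha.le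
      (hbc.trans hc).le haU.2 hbU.2 ⟨ht.1, htb⟩ htU) hcU.1
    have := h.injOn ⟨ha.le.trans hu.1, hu.2.trans (hbc.trans hc).le⟩
      ⟨(ha.trans (hab.trans hbc)).le, hc.le⟩ huc
    linarith [hu.2]
  · exact hbU.2 htU
  · obtain ⟨u, hu, huc⟩ := hcl b c (ha.trans hab).le hc.le (h.subset_image_Ioo hU
      (ha.trans hab).le hc.le hbU.2 hcU.2 ⟨htb, ht.2⟩ htU) haU.1
    have := h.injOn ⟨(ha.trans hab).le.trans hu.1, hu.2.trans hc.le⟩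
      ⟨ha.le, (hab.trans (hbc.trans hc)).le⟩ huc
    linarith [hu.1]

theorem finite_closure_diff (h : IsFreeArc φ) {U : Set G} (hU : IsPreconnected U) :
    {t | t ∈ Ioo (0 : ℝ) 1 ∧ φ t ∈ closure U \ U}.Finite := by
  set T := {t | t ∈ Ioo (0 : ℝ) 1 ∧ φ t ∈ closure U \ U}
  have h3 : ∀ a ∈ T, ∀ b ∈ T, ∀ c ∈ T, a < b → b < c → False := fun a ha b hb c hc hab hbc =>
    h.not_three_mem_closure_diff hU ha.1.1 hab hbc hc.1.2 ha.2 hb.2 hc.2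
  by_cases hs : ∃ a ∈ T, ∃ b ∈ T, a < b
  · obtain ⟨a, ha, b, hb, hab⟩ := hs
    refine (toFinite {a, b}).subset fun t ht => ?_
    rcases lt_trichotomy t a with hta | rfl | hta
    · exact (h3 t ht a ha b hb hta hab).elim
    · exact Or.inl rfl
    · rcases lt_trichotomy t b with htb | rfl | htb
      · exact (h3 a ha t ht b hb hta htb).elim
      · exact Or.inr rfl
      · exact (h3 a ha b hb t ht hab htb).elim
  · push Not at hs
    exact Set.Subsingleton.finite fun a ha b hb => le_antisymm (hs b hb a ha) (hs a ha b hb)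

/-- Near its initial point, a free arc starting outside a connected set `X` is either contained
in `X` or disjoint from `X`. -/
theorem exists_subset_or_disjoint (h : IsFreeArc φ) {X : Set G} (hX : IsPreconnected X)
    (h0 : φ 0 ∉ X) :
    ∃ s ∈ Ioc (0 : ℝ) 1, φ '' Ioo 0 s ⊆ X ∨ Disjoint (φ '' Ioo 0 s) X := by
  by_cases hd : Disjoint (φ '' Ioo 0 1) X
  · exact ⟨1, ⟨one_pos, le_rfl⟩, Or.inr hd⟩
  obtain ⟨_, ⟨s, hs, rfl⟩, hsX⟩ := not_disjoint_iff.1 hd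
  by_cases hcon : φ '' Ioo 0 s ⊆ X
  · exact ⟨s, ⟨hs.1, hs.2.le⟩, Or.inl hcon⟩
  obtain ⟨_, ⟨t, ht, rfl⟩, htX⟩ := not_subset.1 hcon
  refine ⟨t, ⟨ht.1, (ht.2.trans hs.2).le⟩, Or.inr (disjoint_left.2 ?_)⟩
  rintro _ ⟨v, hv, rfl⟩ hvX
  obtain ⟨w, hw, hws⟩ := h.subset_image_Ioo hX le_rfl (ht.2.trans hs.2).le h0 htX hv hvX hsX
  have := h.injOn ⟨hw.1.le, (hw.2.trans (ht.2.trans hs.2)).le⟩ ⟨hs.1.le, hs.2.le⟩ hws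
  linarith [hw.2, ht.2]

end IsFreeArc

theorem exists_mem_Ioc_forall {κ : Type*} [Finite κ] {P : κ → ℝ → Prop}
    (h : ∀ k, ∃ s ∈ Ioc (0 : ℝ) 1, P k s) (hP : ∀ k s t, 0 < s → s ≤ t → P k t → P k s) :
    ∃ s ∈ Ioc (0 : ℝ) 1, ∀ k, P k s := by
  have h' : ∀ᶠ s in 𝓝[>] (0 : ℝ), ∀ k, P k s := by
    refine eventually_all.2 fun k => ?_
    obtain ⟨s, hs, hsP⟩ := h k
    filter_upwards [Ioo_mem_nhdsGT hs.1] with r hr using hP k r s hr.1 hr.2.le hsP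
  obtain ⟨s, hs, hs'⟩ := (h'.and (Ioo_mem_nhdsGT one_pos)).exists
  exact ⟨s, ⟨hs'.1, hs'.2.le⟩, hs⟩

theorem IsEdgeSystem.finite_closure_diff {G ι : Type*} [TopologicalSpace G] [T2Space G] [Finite ι]
    {V : Set G} {φ : ι → ℝ → G} (h : IsEdgeSystem V φ) {U : Set G} (hU : IsPreconnected U) :
    (closure U \ U).Finite := by
  refine (h.finite.union (finite_iUnion fun i =>
    ((h.isFreeArc i).finite_closure_diff hU).image (φ i))).subset fun x hx => ?_
  by_cases hxV : x ∈ V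
  · exact Or.inl hxV
  · obtain ⟨i, t, ht, rfl⟩ := h.cover x hxV
    exact Or.inr (mem_iUnion.2 ⟨i, t, ⟨ht, hx⟩, rfl⟩)

/-- Every point of a graph has a neighbourhood basis of finite stars of free arcs. -/
theorem IsEdgeSystem.exists_star.{u} {G : Type*} {ι : Type u} [TopologicalSpace G] [T2Space G]
    [Finite ι] {V : Set G} {φ : ι → ℝ → G} (h : IsEdgeSystem V φ) (y : G) :
    ∃ (κ : Type u) (_ : Finite κ) (ψ : κ → ℝ → G), (∀ k, IsFreeArc (ψ k)) ∧ (∀ k, ψ k 0 = y) ∧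
      (∀ k l, k ≠ l → Disjoint (ψ k '' Ioo 0 1) (ψ l '' Ioo 0 1)) ∧
      ∀ s ∈ Ioc (0 : ℝ) 1, insert y (⋃ k, ψ k '' Ioo 0 s) ∈ 𝓝 y := by
  set q : Bool → ℝ := fun b => if b then 1 else 0 with hq
  have hq01 : ∀ b, q b ∈ Icc (0 : ℝ) 1 := by
    intro b
    cases b <;> simp [hq]
  set κ : Type u := {k : ι × Bool // ∃ t ∈ Icc (0 : ℝ) 1, φ k.1 t = y ∧ t ≠ q k.2}
  choose P hP hPy hPq using fun k : κ => k.2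
  set ψ : κ → ℝ → G := fun k t => φ k.1.1 (P k + t * (q k.1.2 - P k)) with hψ
  have hψa : ∀ k, IsFreeArc (ψ k) := fun k =>
    (h.isFreeArc k.1.1).comp_affine (hP k) (hq01 _) (hPq k)
  have hψ0 : ∀ k, ψ k 0 = y := fun k => by simp [hψ, hPy]
  have hm : ∀ k, ∀ t ∈ Ioo (0 : ℝ) 1, P k + t * (q k.1.2 - P k) ∈ Ioo (0 : ℝ) 1 := by
    rintro ⟨⟨i, b⟩, hk⟩ t ht
    have h1 := hP ⟨(i, b), hk⟩
    have h2 := hPq ⟨(i, b), hk⟩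
    generalize P ⟨(i, b), hk⟩ = p at *
    cases b
    · have : 0 < p := lt_of_le_of_ne h1.1 (Ne.symm (by simpa [hq] using h2))
      simp only [hq]
      constructor
      · simp; nlinarith [ht.1, ht.2]
      · simp; nlinarith [ht.1, ht.2, h1.2]
    · have : p < 1 := lt_of_le_of_ne h1.2 (by simpa [hq] using h2)
      simp only [hq]
      constructor
      · simp; nlinarith [ht.1, ht.2, h1.1]
      · simp; nlinarith [ht.1, ht.2]
  refine ⟨κ, inferInstance, ψ, hψa, hψ0, ?_, ?_⟩
  · intro k l hkl
    by_cases hi : k.1.1 = l.1.1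
    · refine disjoint_left.2 ?_
      rintro _ ⟨t, ht, rfl⟩ ⟨u, hu, hut⟩
      have hPe : P k = P l := (h.isFreeArc k.1.1).injOn (hP k) (hP l)
        ((hPy k).trans (by rw [hi]; exact (hPy l).symm))
      have hb : k.1.2 ≠ l.1.2 := fun hb => hkl (Subtype.ext (Prod.ext hi hb))
      have hut' : P l + u * (q l.1.2 - P l) = P k + t * (q k.1.2 - P k) := by
        refine (h.isFreeArc k.1.1).injOn (Ioo_subset_Icc_self (hm l u hu))
          (Ioo_subset_Icc_self (hm k t ht)) ?_
        simpa only [hψ, hi] using hut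
      have hk := hPq k
      have hl := hPq l
      have h01 := hP l
      rw [hPe] at hut' hk
      generalize P l = p at *
      cases hbk : k.1.2 <;> cases hbl : l.1.2 <;> simp [hbk, hbl, hq] at hb hk hl hut'
      · have : p < 1 := lt_of_le_of_ne h01.2 hl
        nlinarith [mul_pos hu.1 (sub_pos.2 this), mul_nonneg ht.1.le h01.1]
      · have : p < 1 := lt_of_le_of_ne h01.2 hk
        nlinarith [mul_pos ht.1 (sub_pos.2 this), mul_nonneg hu.1.le h01.1]
    · refine (h.disjoint _ _ hi).mono ?_ ?_
      · rintro _ ⟨t, ht, rfl⟩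
        exact ⟨_, hm k t ht, rfl⟩
      · rintro _ ⟨t, ht, rfl⟩
        exact ⟨_, hm l t ht, rfl⟩
  · intro s hs
    set F : Set G := (V \ {y}) ∪ (⋃ i : {i : ι // y ∉ φ i '' Icc 0 1}, φ i '' Icc 0 1) ∪
      ⋃ k, ψ k '' Icc s 1 with hF
    have hFc : IsClosed F := by
      refine (IsClosed.union ?_ ?_).union ?_
      · exact (h.finite.subset sdiff_subset).isClosed
      · exact isClosed_iUnion_of_finite fun i => (h.isFreeArc i).isClosed_image le_rfl le_rfl
      · exact isClosed_iUnion_of_finite fun k => (hψa k).isClosed_image hs.1.le le_rfl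
    have hyF : y ∉ F := by
      rintro ((hy | hy) | hy)
      · exact hy.2 rfl
      · obtain ⟨i, hi⟩ := mem_iUnion.1 hy
        exact i.2 hi
      · obtain ⟨k, t, ht, hty⟩ := mem_iUnion.1 hy
        have := (hψa k).injOn ⟨hs.1.le.trans ht.1, ht.2⟩ ⟨le_rfl, zero_le_one⟩
          (hty.trans (hψ0 k).symm)
        linarith [hs.1, ht.1]
    refine mem_of_superset (hFc.isOpen_compl.mem_nhds hyF) fun x hx => ?_
    by_cases hxy : x = y
    · exact Or.inl hxy
    refine Or.inr ?_
    have hxV : x ∉ V := fun hxV => hx (Or.inl (Or.inl ⟨hxV, hxy⟩))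
    obtain ⟨i, t, ht, rfl⟩ := h.cover x hxV
    have hyi : y ∈ φ i '' Icc 0 1 := by
      by_contra hyi
      exact hx (Or.inl (Or.inr (mem_iUnion.2 ⟨⟨i, hyi⟩, t, Ioo_subset_Icc_self ht, rfl⟩)))
    obtain ⟨p, hp, hpy⟩ := hyi
    have htp : t ≠ p := by
      rintro rfl
      exact hxy hpy
    obtain ⟨b, hb, hu⟩ : ∃ b, p ≠ q b ∧ (t - p) / (q b - p) ∈ Ioo (0 : ℝ) 1 := by
      rcases lt_or_gt_of_ne htp with htp | htp
      · refine ⟨false, ?_, ?_⟩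
        · simp only [hq]
          simpa using (ht.1.trans htp).ne'
        · have h0 : 0 < p := ht.1.trans htp
          have : (t - p) / (q false - p) = (p - t) / p := by
            simp only [hq, Bool.false_eq_true, if_false, zero_sub]
            rw [← neg_sub p t, neg_div_neg_eq]
          rw [this]
          exact ⟨div_pos (sub_pos.2 htp) h0, (div_lt_one h0).2 (by linarith [ht.1])⟩
      · have h0 : 0 < 1 - p := by linarith [ht.2]
        refine ⟨true, ?_, ?_⟩
        · simp only [hq, if_true]
          linarith
        · simp only [hq, if_true]
          exact ⟨div_pos (sub_pos.2 htp) h0, (div_lt_one h0).2 (by linarith [ht.2])⟩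
    let k : κ := ⟨(i, b), p, hp, hpy, hb⟩
    have hPk : P k = p := (h.isFreeArc i).injOn (hP k) hp ((hPy k).trans hpy.symm)
    have hkx : ψ k ((t - p) / (q b - p)) = φ i t := by
      simp only [hψ, hPk]
      congr 1
      have : q b - p ≠ 0 := sub_ne_zero.2 hb.symm
      simp only [k]
      field_simp
      ring
    refine mem_iUnion.2 ⟨k, _, ⟨hu.1, ?_⟩, hkx⟩
    by_contra! hsu
    exact hx (Or.inr (mem_iUnion.2 ⟨k, _, ⟨hsu, hu.2.le⟩, hkx⟩))

theorem IsEdgeSystem.exists_ends.{u} {G : Type*} {ι : Type u} [TopologicalSpace G] [T2Space G]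
    [Finite ι] {V : Set G} {φ : ι → ℝ → G} (h : IsEdgeSystem V φ) {X : Set G}
    (hX : IsPreconnected X) {y : G} (hy : y ∉ X) {U : Set G} (hU : U ∈ 𝓝 y) :
    ∃ (κ : Type u) (_ : Finite κ) (e : κ → ℝ → G), (∀ k, IsFreeArc (e k)) ∧ (∀ k, e k 0 = y) ∧
      (∀ k l, k ≠ l → Disjoint (e k '' Ioo 0 1) (e l '' Ioo 0 1)) ∧
      (∀ k, e k '' Ioc 0 1 ⊆ X ∩ U) ∧
      ∀ s ∈ Ioc (0 : ℝ) 1, ∃ W ∈ 𝓝 y, W ∩ X ⊆ ⋃ k, e k '' Ioo 0 s := by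
  obtain ⟨κ, _, ψ, hψ, hψ0, hd, hn⟩ := h.exists_star y
  obtain ⟨s, hs, hsX, hsU⟩ : ∃ s ∈ Ioc (0 : ℝ) 1,
      (∀ k, ψ k '' Ioo 0 s ⊆ X ∨ Disjoint (ψ k '' Ioo 0 s) X) ∧ ∀ k, ψ k '' Ioo 0 s ⊆ U := by
    have := exists_mem_Ioc_forall (P := fun (k : κ ⊕ κ) s => k.elim
      (fun k => ψ k '' Ioo 0 s ⊆ X ∨ Disjoint (ψ k '' Ioo 0 s) X) (fun k => ψ k '' Ioo 0 s ⊆ U))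
      ?_ ?_
    · obtain ⟨s, hs, hs'⟩ := this
      exact ⟨s, hs, fun k => hs' (Sum.inl k), fun k => hs' (Sum.inr k)⟩
    · rintro (k | k)
      · exact (hψ k).exists_subset_or_disjoint hX (by rwa [hψ0])
      · exact (hψ k).exists_image_Ioo_subset (by rwa [hψ0])
    · rintro (k | k) s t _ hst hk
      · exact hk.imp (image_mono (Ioo_subset_Ioo_right hst)).trans
          (Disjoint.mono_left (image_mono (Ioo_subset_Ioo_right hst)))
      · exact (image_mono (Ioo_subset_Ioo_right hst)).trans hk
  have h2 : 0 < s / 2 := half_pos hs.1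
  have h21 : s / 2 < 1 := by linarith [hs.2, hs.1]
  set e : κ → ℝ → G := fun k t => ψ k (0 + t * (s / 2 - 0)) with he
  have hes : ∀ k, e k '' Ioc 0 1 ⊆ ψ k '' Ioo 0 s := by
    rintro k _ ⟨t, ht, rfl⟩
    refine ⟨_, ⟨?_, ?_⟩, rfl⟩
    · have := mul_pos ht.1 h2
      linarith
    · have := mul_le_mul_of_nonneg_right ht.2 h2.le
      linarith
  refine ⟨{k // ψ k '' Ioo 0 s ⊆ X}, inferInstance, fun k => e k,
    fun k => (hψ k).comp_affine ⟨le_rfl, zero_le_one⟩ ⟨h2.le, h21.le⟩ h2.ne,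
    fun k => by simp [he, hψ0], ?_, ?_, ?_⟩
  · intro k l hkl
    refine (hd k l (fun hh => hkl (Subtype.ext hh))).mono ?_ ?_
    · exact (image_mono Ioo_subset_Ioc_self).trans
        ((hes k).trans (image_mono (Ioo_subset_Ioo_right hs.2)))
    · exact (image_mono Ioo_subset_Ioc_self).trans
        ((hes l).trans (image_mono (Ioo_subset_Ioo_right hs.2)))
  · exact fun k => subset_inter ((hes k).trans k.2) ((hes k).trans (hsU k))
  · intro r hr
    have hr2 : r * (s / 2) ≤ s / 2 := mul_le_of_le_one_left h2.le hr.2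
    refine ⟨_, hn (r * (s / 2)) ⟨mul_pos hr.1 h2, by linarith⟩, ?_⟩
    rintro x ⟨rfl | hx, hxX⟩
    · exact (hy hxX).elim
    obtain ⟨k, t, ht, rfl⟩ := mem_iUnion.1 hx
    have hk : ψ k '' Ioo 0 s ⊆ X := by
      refine (hsX k).resolve_right fun hdis => ?_
      exact disjoint_left.1 hdis ⟨t, ⟨ht.1, by linarith [ht.2]⟩, rfl⟩ hxX
    refine mem_iUnion.2 ⟨⟨k, hk⟩, t / (s / 2), ⟨div_pos ht.1 h2, (div_lt_iff₀ h2).2 ht.2⟩, ?_⟩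
    simp only [he]
    rw [sub_zero, zero_add, div_mul_cancel₀ t (ne_of_gt h2)]

/-- A system of disjoint arcs in `X` tending to the points of `closure X \ X`, the ends of `X`,
whose complement in `X` is compact. -/
structure IsEndSystem {G ι : Type*} [TopologicalSpace G] (X : Set G) (e : ι → ℝ → G) : Prop where
  isFreeArc : ∀ i, IsFreeArc (e i)
  zero_notMem : ∀ i, e i 0 ∉ X
  image_subset : ∀ i, e i '' Ioc 0 1 ⊆ X
  disjoint : ∀ i j, i ≠ j → Disjoint (e i '' Ioo 0 1) (e j '' Ioo 0 1)
  isCompact_core : ∀ s ∈ Ioc (0 : ℝ) 1, IsCompact (X \ ⋃ i, e i '' Ioo 0 s)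

theorem IsEdgeSystem.exists_isEndSystem.{u} {G ι : Type u} [TopologicalSpace G] [T2Space G]
    [CompactSpace G] [Finite ι] {V : Set G} {φ : ι → ℝ → G} (h : IsEdgeSystem V φ) {X : Set G}
    (hX : IsPreconnected X) (hnt : (closure X \ X).Nontrivial) :
    ∃ (κ : Type u) (_ : Finite κ) (_ : Nontrivial κ) (e : κ → ℝ → G), IsEndSystem X e := by
  have hfin := h.finite_closure_diff hX
  obtain ⟨U, hU, hUd⟩ := hfin.t2_separation
  have : Finite ↥(closure X \ X) := hfin
  choose κ hκ e he he0 hed heX heW using fun y : ↥(closure X \ X) =>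
    h.exists_ends hX y.2.2 ((hU y).2.mem_nhds (hU y).1)
  have hne : ∀ y, Nonempty (κ y) := by
    intro y
    obtain ⟨W, hW, hWX⟩ := heW y 1 ⟨one_pos, le_rfl⟩
    obtain ⟨x, hx⟩ := mem_closure_iff_nhds.1 y.2.1 W hW
    obtain ⟨k, -⟩ := mem_iUnion.1 (hWX hx)
    exact ⟨k⟩
  refine ⟨Σ y, κ y, inferInstance, ?_, fun k => e k.1 k.2,
    fun k => he _ _, fun k => ?_, fun k => (heX _ _).trans inter_subset_left, ?_, ?_⟩
  · obtain ⟨y, hy, z, hz, hyz⟩ := hnt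
    exact ⟨⟨⟨y, hy⟩, (hne _).some⟩, ⟨⟨z, hz⟩, (hne _).some⟩, fun hh =>
      hyz (congrArg Subtype.val (congrArg Sigma.fst hh))⟩
  · rw [he0]
    exact k.1.2.2
  · rintro ⟨y, k⟩ ⟨z, l⟩ hkl
    by_cases hyz : y = z
    · subst hyz
      exact hed y k l fun hh => hkl (by rw [hh])
    · refine (hUd y.2 z.2 fun hh => hyz (Subtype.ext hh)).mono ?_ ?_
      · exact (image_mono Ioo_subset_Ioc_self).trans ((heX y k).trans inter_subset_right)
      · exact (image_mono Ioo_subset_Ioc_self).trans ((heX z l).trans inter_subset_right)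
  · intro s hs
    refine (isClosed_of_closure_subset fun x hx => ?_).isCompact
    by_cases hxX : x ∈ X
    · refine ⟨hxX, fun hxe => ?_⟩
      obtain ⟨z, hz, hz'⟩ := mem_closure_iff.1 hx _
        (isOpen_iUnion fun k : Σ y, κ y => (he k.1 k.2).isOpen_image le_rfl hs.2) hxe
      exact hz'.2 hz
    · obtain ⟨W, hW, hWX⟩ := heW ⟨x, closure_mono sdiff_subset hx, hxX⟩ s hs
      obtain ⟨z, hz, hz'⟩ := mem_closure_iff_nhds.1 hx W hW
      obtain ⟨k, hk⟩ := mem_iUnion.1 (hWX ⟨hz, hz'.1⟩)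
      exact (hz'.2 (mem_iUnion.2 ⟨⟨_, k⟩, hk⟩)).elim

theorem IsPreconnected.exists_subset_of_disjoint {G ι : Type*} [TopologicalSpace G] {S : Set G}
    (hS : IsPreconnected S) (hne : S.Nonempty) {U : ι → Set G} (hU : ∀ i, IsOpen (U i))
    (hd : ∀ i j, i ≠ j → Disjoint (U i) (U j)) (hSU : S ⊆ ⋃ i, U i) : ∃ i, S ⊆ U i := by
  obtain ⟨x, hx⟩ := hne
  obtain ⟨i, hi⟩ := mem_iUnion.1 (hSU hx)
  refine ⟨i, IsPreconnected.subset_left_of_subset_union (hU i)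
    (v := ⋃ j : {j // j ≠ i}, U j) (isOpen_iUnion fun j => hU j)
    (disjoint_iUnion_right.2 fun j => hd i j j.2.symm) (fun y hy => ?_) ⟨x, hx, hi⟩ hS⟩
  obtain ⟨j, hj⟩ := mem_iUnion.1 (hSU hy)
  by_cases hji : j = i
  · exact Or.inl (hji ▸ hj)
  · exact Or.inr (mem_iUnion.2 ⟨⟨j, hji⟩, hj⟩)

/-! ### Dynamics of ends -/

/-- `f` maps the germ of the arc `e i` at its initial point into that of `e j`. -/
def EndMap {G ι : Type*} (f : G → G) (e : ι → ℝ → G) (i j : ι) : Prop :=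
  ∀ r ∈ Ioc (0 : ℝ) 1, ∃ s ∈ Ioc (0 : ℝ) 1, f '' (e i '' Ioo 0 s) ⊆ e j '' Ioo 0 r

theorem EndMap.iterate {G ι : Type*} {f : G → G} {e : ι → ℝ → G} {σ : ι → ι}
    (h : ∀ i, EndMap f e i (σ i)) (n : ℕ) (i : ι) : EndMap f^[n] e i (σ^[n] i) := by
  induction n generalizing i with
  | zero => exact fun r hr => ⟨r, hr, by simp⟩
  | succ n ih =>
    intro r hr
    obtain ⟨s, hs, hsr⟩ := ih (σ i) r hr
    obtain ⟨t, ht, hts⟩ := h i s hs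
    refine ⟨t, ht, ?_⟩
    rw [iterate_succ, iterate_succ, image_comp]
    exact (image_mono hts).trans hsr

theorem EndMap.exists_common {G ι : Type*} [Finite ι] {f : G → G} {e : ι → ℝ → G} {σ : ι → ι}
    (hσ : ∀ i, EndMap f e i (σ i)) :
    ∃ s ∈ Ioc (0 : ℝ) 1, ∀ i, f '' (e i '' Ioo 0 s) ⊆ e (σ i) '' Ioo 0 1 :=
  exists_mem_Ioc_forall (fun i => hσ i 1 ⟨one_pos, le_rfl⟩)
    fun _ _ _ _ hst => (image_mono (image_mono (Ioo_subset_Ioo_right hst))).trans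

namespace IsEndSystem

variable {G ι : Type*} [TopologicalSpace G] {X : Set G} {e : ι → ℝ → G}

theorem image_Ioo_subset (h : IsEndSystem X e) (i : ι) {s : ℝ} (hs : s ≤ 1) :
    e i '' Ioo 0 s ⊆ X :=
  (image_mono fun _ ht => mem_Ioc.2 ⟨ht.1, (ht.2.trans_le hs).le⟩).trans (h.image_subset i)

theorem eq_of_mem (h : IsEndSystem X e) {i j : ι} {x : G} (hi : x ∈ e i '' Ioo 0 1)
    (hj : x ∈ e j '' Ioo 0 1) : i = j := by
  by_contra hij
  exact disjoint_left.1 (h.disjoint i j hij) hi hj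

variable [T2Space G]

theorem exists_disjoint (h : IsEndSystem X e) {C : Set G} (hC : IsCompact C) (hCX : C ⊆ X)
    (i : ι) : ∃ s ∈ Ioc (0 : ℝ) 1, Disjoint (e i '' Ioo 0 s) C := by
  obtain ⟨s, hs, hsC⟩ := (h.isFreeArc i).exists_image_Ioo_subset
    (hC.isClosed.isOpen_compl.mem_nhds fun h0 => h.zero_notMem i (hCX h0))
  exact ⟨s, hs, disjoint_left.2 hsC⟩

theorem exists_endMap (h : IsEndSystem X e) {f : G → G} (hf : Continuous f) (hfX : MapsTo f X X)
    (hprop : ∀ C ⊆ X, IsCompact C → IsCompact (X ∩ f ⁻¹' C)) (i : ι) : ∃ j, EndMap f e i j := by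
  have key : ∀ r ∈ Ioc (0 : ℝ) 1, ∃ s ∈ Ioc (0 : ℝ) 1, ∃ j,
      f '' (e i '' Ioo 0 s) ⊆ e j '' Ioo 0 r := by
    intro r hr
    obtain ⟨s, hs, hd⟩ := h.exists_disjoint (hprop _ sdiff_subset (h.isCompact_core r hr))
      inter_subset_left i
    refine ⟨s, hs, IsPreconnected.exists_subset_of_disjoint ?_ ?_
      (fun j => (h.isFreeArc j).isOpen_image le_rfl hr.2)
      (fun j k hjk => (h.disjoint j k hjk).mono (image_mono (Ioo_subset_Ioo_right hr.2))
        (image_mono (Ioo_subset_Ioo_right hr.2))) ?_⟩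
    · exact (isPreconnected_Ioo.image _ ((h.isFreeArc i).continuousOn.mono
        (Ioo_subset_Icc_self.trans (Icc_subset_Icc_right hs.2)))).image _ hf.continuousOn
    · exact ((nonempty_Ioo.2 hs.1).image _).image _
    · rintro _ ⟨x, hx, rfl⟩
      have hxX := h.image_Ioo_subset i hs.2 hx
      by_contra hn
      exact disjoint_left.1 hd hx ⟨hxX, hfX hxX, hn⟩
  obtain ⟨s, hs, j, hj⟩ := key 1 ⟨one_pos, le_rfl⟩
  refine ⟨j, fun r hr => ?_⟩
  obtain ⟨t, ht, k, hk⟩ := key r hr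
  have hm : 0 < min s t := lt_min hs.1 ht.1
  have hx1 : f (e i (min s t / 2)) ∈ e j '' Ioo 0 1 :=
    hj ⟨_, ⟨_, ⟨half_pos hm, (half_lt_self hm).trans_le (min_le_left _ _)⟩, rfl⟩, rfl⟩
  have hx2 : f (e i (min s t / 2)) ∈ e k '' Ioo 0 r :=
    hk ⟨_, ⟨_, ⟨half_pos hm, (half_lt_self hm).trans_le (min_le_right _ _)⟩, rfl⟩, rfl⟩
  rw [h.eq_of_mem hx1 (image_mono (Ioo_subset_Ioo_right hr.2) hx2)]
  exact ⟨t, ht, hk⟩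

theorem surjective_of_endMap (h : IsEndSystem X e) [Finite ι] {f : G → G} (hf : Continuous f)
    (hfX : MapsTo f X X) {K : Set G} (hK : IsCompact K) (hKX : K ⊆ X) (hX : X ⊆ K ∪ f '' X)
    {σ : ι → ι} (hσ : ∀ i, EndMap f e i (σ i)) : Surjective σ := by
  intro j
  obtain ⟨s, hs, hsσ⟩ := EndMap.exists_common hσ
  obtain ⟨r, hr, hd⟩ := h.exists_disjoint (hK.union ((h.isCompact_core s hs).image hf))
    (union_subset hKX (image_subset_iff.2 fun x hx => hfX hx.1)) j
  have hjr : e j (r / 2) ∈ e j '' Ioo 0 r := ⟨_, ⟨half_pos hr.1, half_lt_self hr.1⟩, rfl⟩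
  rcases hX (h.image_Ioo_subset j hr.2 hjr) with hjK | ⟨x, hx, hxj⟩
  · exact (disjoint_left.1 hd hjr (Or.inl hjK)).elim
  have hxe : x ∈ ⋃ i, e i '' Ioo 0 s := by
    by_contra hxe
    exact disjoint_left.1 hd hjr (Or.inr ⟨x, ⟨hx, hxe⟩, hxj⟩)
  obtain ⟨i, hi⟩ := mem_iUnion.1 hxe
  refine ⟨i, h.eq_of_mem (hsσ i ⟨x, hi, rfl⟩) ?_⟩
  rw [hxj]
  exact image_mono (Ioo_subset_Ioo_right hr.2) hjr

theorem exists_iterate_endMap (h : IsEndSystem X e) [Finite ι] {f : G → G} (hf : Continuous f)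
    (hfX : MapsTo f X X) (hprop : ∀ C ⊆ X, IsCompact C → IsCompact (X ∩ f ⁻¹' C))
    {K : Set G} (hK : IsCompact K) (hKX : K ⊆ X) (hX : X ⊆ K ∪ f '' X) :
    ∃ N, 0 < N ∧ ∀ i, EndMap f^[N] e i i := by
  choose σ hσ using h.exists_endMap hf hfX hprop
  have hs := h.surjective_of_endMap hf hfX hK hKX hX hσ
  set τ : Equiv.Perm ι := Equiv.ofBijective σ ⟨Finite.injective_iff_surjective.2 hs, hs⟩
  refine ⟨orderOf τ, orderOf_pos τ, fun i => ?_⟩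
  have := EndMap.iterate hσ (orderOf τ) i
  have hτ : σ^[orderOf τ] i = i := by
    change (τ : ι → ι)^[orderOf τ] i = i
    rw [Equiv.Perm.iterate_eq_pow, pow_orderOf_eq_one]
    rfl
  rwa [hτ] at this

/-- If an end of the orbit `X` of a compact set is mapped into itself by a map without periodic
points in `X`, then it has a forward invariant neighbourhood. -/
theorem exists_image_subset_self (h : IsEndSystem X e) [Finite ι] {g : G → G} (hg : Continuous g)
    {K : Set G} (hK : IsCompact K) (hX : X = setOrbit g K) (hgX : MapsTo g X X)
    (hend : ∀ i, EndMap g e i i) (hper : ∀ x ∈ X, x ∉ periodicPts g) (i : ι) :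
    ∃ s ∈ Ioc (0 : ℝ) 1, g '' (e i '' Ioo 0 s) ⊆ e i '' Ioo 0 s := by
  obtain ⟨s, hs, hse⟩ := EndMap.exists_common hend
  have hinj := (h.isFreeArc i).injOn
  have hs01 : Ioo 0 s ⊆ Ioo 0 1 := Ioo_subset_Ioo_right hs.2
  have hu : ∀ t : ℝ, ∃ v, t ∈ Ioo 0 s → v ∈ Ioo (0 : ℝ) 1 ∧ e i v = g (e i t) := by
    intro t
    by_cases ht : t ∈ Ioo 0 s
    · obtain ⟨v, hv, hvt⟩ := hse i ⟨_, ⟨t, ht, rfl⟩, rfl⟩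
      exact ⟨v, fun _ => ⟨hv, hvt⟩⟩
    · exact ⟨0, fun ht' => (ht ht').elim⟩
  choose u hu using hu
  have hcont : ContinuousOn u (Ioo 0 s) := by
    intro t ht
    have hgc : ContinuousWithinAt (fun t => g (e i t)) (Ioo 0 s) t :=
      hg.continuousAt.comp_continuousWithinAt (((h.isFreeArc i).continuousOn.mono
        (hs01.trans Ioo_subset_Icc_self)) t ht)
    have aux : ∀ a b, 0 ≤ a → b ≤ 1 → u t ∈ Ioo a b → ∀ᶠ t' in 𝓝[Ioo 0 s] t, u t' ∈ Ioo a b := by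
      intro a b ha hb hab
      have hmem : e i '' Ioo a b ∈ 𝓝 (g (e i t)) :=
        ((h.isFreeArc i).isOpen_image ha hb).mem_nhds ⟨u t, hab, (hu t ht).2⟩
      filter_upwards [hgc hmem, self_mem_nhdsWithin] with t' ht' ht'm
      obtain ⟨v, hv, hvt⟩ := ht'
      have : v = u t' := hinj ⟨ha.trans hv.1.le, hv.2.le.trans hb⟩
        (Ioo_subset_Icc_self (hu t' ht'm).1) (hvt.trans (hu t' ht'm).2.symm)
      exact this ▸ hv
    refine tendsto_order.2 ⟨fun a ha => ?_, fun b hb => ?_⟩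
    · filter_upwards [aux (max a 0) 1 (le_max_right _ _) le_rfl
        ⟨max_lt ha (hu t ht).1.1, (hu t ht).1.2⟩] with t' ht' using (le_max_left _ _).trans_lt ht'.1
    · filter_upwards [aux 0 (min b 1) le_rfl (min_le_right _ _)
        ⟨(hu t ht).1.1, lt_min hb (hu t ht).1.2⟩] with t' ht' using ht'.2.trans_le (min_le_left _ _)
  have hfix : ∀ t ∈ Ioo 0 s, u t ≠ t := by
    intro t ht hut
    refine hper (e i t) (h.image_Ioo_subset i hs.2 ⟨t, ht, rfl⟩) ⟨1, one_pos, ?_⟩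
    have := (hu t ht).2
    rw [hut] at this
    exact this.symm
  by_cases hlt : ∀ t ∈ Ioo 0 s, u t ≤ t
  · refine ⟨s, hs, ?_⟩
    rintro _ ⟨_, ⟨t, ht, rfl⟩, rfl⟩
    exact ⟨u t, ⟨(hu t ht).1.1, (hlt t ht).trans_lt ht.2⟩, (hu t ht).2⟩
  exfalso
  push Not at hlt
  obtain ⟨t₀, ht₀, hut₀⟩ := hlt
  have hgt : ∀ t ∈ Ioo 0 s, t < u t := by
    intro t ht
    by_contra! hut
    obtain ⟨v, hv, hvu⟩ := isPreconnected_Ioo.intermediate_value₂ ht ht₀ hcont continuousOn_id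
      hut hut₀.le
    exact hfix v hv hvu
  have hKX : K ⊆ X := by
    rw [hX]
    exact fun x hx => mem_iUnion.2 ⟨0, x, hx, rfl⟩
  obtain ⟨r, hr, hd⟩ := h.exists_disjoint (hK.union ((h.isCompact_core s hs).image hg))
    (union_subset hKX (image_subset_iff.2 fun x hx => hgX hx.1)) i
  have claim : ∀ n, ∀ k ∈ K, g^[n] k ∉ e i '' Ioo 0 r := by
    intro n k hk
    induction n with
    | zero => exact fun hn => disjoint_left.1 hd hn (Or.inl hk)
    | succ n ih =>
      intro hn
      have hxX : g^[n] k ∈ X := hgX.iterate n (hKX hk)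
      rw [iterate_succ_apply'] at hn
      have hxe : g^[n] k ∈ ⋃ i, e i '' Ioo 0 s := by
        by_contra hxe
        exact disjoint_left.1 hd hn (Or.inr ⟨_, ⟨hxX, hxe⟩, rfl⟩)
      obtain ⟨j, hj⟩ := mem_iUnion.1 hxe
      obtain rfl : j = i := h.eq_of_mem (hse j ⟨_, hj, rfl⟩)
        (image_mono (Ioo_subset_Ioo_right hr.2) hn)
      obtain ⟨t, ht, htx⟩ := hj
      obtain ⟨v, hv, hvx⟩ := hn
      have hvu : v = u t := hinj ⟨hv.1.le, (hv.2.trans_le hr.2).le⟩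
        (Ioo_subset_Icc_self (hu t ht).1) (by rw [hvx, (hu t ht).2, htx])
      exact ih ⟨t, ⟨ht.1, (hgt t ht).trans (hvu ▸ hv.2)⟩, htx⟩
  have hir : e i (r / 2) ∈ e i '' Ioo 0 r := ⟨_, ⟨half_pos hr.1, half_lt_self hr.1⟩, rfl⟩
  have := h.image_Ioo_subset i hr.2 hir
  rw [hX] at this
  obtain ⟨n, k, hk, hkn⟩ := mem_iUnion.1 this
  exact claim n k hk (hkn ▸ hir)

end IsEndSystem

/-- A self-map of a finite set has a periodic point in it. -/
theorem Set.MapsTo.exists_mem_periodicPts {α : Type*} {g : α → α} {F : Set α} (h : MapsTo g F F)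
    (hF : F.Finite) (hne : F.Nonempty) : ∃ x ∈ F, x ∈ periodicPts g := by
  obtain ⟨x, hx⟩ := hne
  have := hF.to_subtype
  obtain ⟨m, n, hmn, heq⟩ := Finite.exists_ne_map_eq_of_infinite
    fun n : ℕ => (⟨g^[n] x, h.iterate n hx⟩ : F)
  wlog hlt : m < n generalizing m n
  · exact this n m hmn.symm heq.symm (by omega)
  refine ⟨g^[m] x, h.iterate m hx, n - m, by omega, ?_⟩
  have heq' : g^[m] x = g^[n] x := congrArg Subtype.val heq
  rw [IsPeriodicPt, IsFixedPt, ← iterate_add_apply, Nat.sub_add_cancel hlt.le, heq']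

theorem mapsTo_setOrbit {G : Type*} (f : G → G) (K : Set G) :
    MapsTo f (setOrbit f K) (setOrbit f K) := by
  intro x hx
  obtain ⟨n, k, hk, rfl⟩ := mem_iUnion.1 hx
  exact mem_iUnion.2 ⟨n + 1, k, hk, iterate_succ_apply' f n k⟩

theorem subset_setOrbit {G : Type*} (f : G → G) (K : Set G) : K ⊆ setOrbit f K :=
  fun x hx => mem_iUnion.2 ⟨0, x, hx, rfl⟩

theorem setOrbit_subset_union_image {G : Type*} (f : G → G) (K : Set G) :
    setOrbit f K ⊆ K ∪ f '' setOrbit f K := by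
  intro x hx
  obtain ⟨n, k, hk, rfl⟩ := mem_iUnion.1 hx
  cases n with
  | zero => exact Or.inl hk
  | succ n => exact Or.inr ⟨f^[n] k, mem_iUnion.2 ⟨n, k, hk, rfl⟩, (iterate_succ_apply' f n k).symm⟩

theorem mapsTo_closure_setOrbit_diff {G : Type*} [TopologicalSpace G] [T2Space G] [CompactSpace G]
    {f : G → G} (hf : Continuous f) {K : Set G} (hK : IsClosed K)
    (hfin : (closure (setOrbit f K) \ setOrbit f K).Finite) :
    MapsTo f (closure (setOrbit f K) \ setOrbit f K) (closure (setOrbit f K) \ setOrbit f K) := by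
  set X := setOrbit f K
  have hcl : closure X ⊆ K ∪ f '' closure X :=
    closure_minimal ((setOrbit_subset_union_image f K).trans
      (union_subset_union_right _ (image_mono subset_closure)))
      (hK.union (isClosed_closure.isCompact.image hf).isClosed)
  have hsub : closure X \ X ⊆ f '' (closure X \ X) := by
    rintro y ⟨hy, hyX⟩
    rcases hcl hy with hyK | ⟨x, hx, rfl⟩
    · exact (hyX (subset_setOrbit f K hyK)).elim
    · exact ⟨x, ⟨hx, fun hxX => hyX (mapsTo_setOrbit f K hxX)⟩, rfl⟩
  rw [mapsTo_iff_image_subset]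
  exact (eq_of_subset_of_ncard_le hsub (ncard_image_le hfin) (hfin.image f)).ge

theorem isCompact_inter_preimage {G : Type*} [TopologicalSpace G] [T2Space G] [CompactSpace G]
    {f : G → G} (hf : Continuous f) {X : Set G}
    (hX : MapsTo f (closure X \ X) (closure X \ X)) {C : Set G} (hCX : C ⊆ X)
    (hC : IsCompact C) : IsCompact (X ∩ f ⁻¹' C) := by
  have : X ∩ f ⁻¹' C = closure X ∩ f ⁻¹' C := by
    refine (inter_subset_inter_left _ subset_closure).antisymm fun x hx => ⟨?_, hx.2⟩
    by_contra hxX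
    exact (hX ⟨hx.1, hxX⟩).2 (hCX hx.2)
  rw [this]
  exact (isClosed_closure.inter (hC.isClosed.preimage hf)).isCompact

theorem isConnected_image_iterate {G : Type*} [TopologicalSpace G] {f : G → G} (hf : Continuous f)
    {K : Set G} (hK : IsConnected K) (n : ℕ) : IsConnected (f^[n] '' K) :=
  hK.image _ (hf.iterate n).continuousOn

theorem nonempty_image_iterate_inter {G : Type*} {f : G → G} {K : Set G}
    (h : (f '' K ∩ K).Nonempty) (n : ℕ) : (f^[n] '' K ∩ f^[n + 1] '' K).Nonempty := by
  obtain ⟨_, ⟨x, hx, rfl⟩, hfx⟩ := h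
  exact ⟨f^[n] (f x), ⟨_, hfx, rfl⟩, x, hx, rfl⟩

theorem isConnected_setOrbit {G : Type*} [TopologicalSpace G] {f : G → G} (hf : Continuous f)
    {K : Set G} (hK : IsConnected K) (h : (f '' K ∩ K).Nonempty) : IsConnected (setOrbit f K) :=
  IsConnected.iUnion_of_chain (isConnected_image_iterate hf hK) (nonempty_image_iterate_inter h)

theorem isConnected_setOrbitSeg {G : Type*} [TopologicalSpace G] {f : G → G} (hf : Continuous f)
    {K : Set G} (hK : IsConnected K) (h : (f '' K ∩ K).Nonempty) (n : ℕ) :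
    IsConnected (setOrbitSeg f K n) :=
  IsConnected.biUnion_of_chain (t := Iic n) nonempty_Iic ordConnected_Iic
    (fun m _ => isConnected_image_iterate hf hK m) fun m _ _ => nonempty_image_iterate_inter h m

theorem isCompact_setOrbitSeg {G : Type*} [TopologicalSpace G] {f : G → G} (hf : Continuous f)
    {K : Set G} (hK : IsCompact K) (n : ℕ) : IsCompact (setOrbitSeg f K n) :=
  (finite_Iic n).isCompact_biUnion fun m _ => hK.image (hf.iterate m)

theorem setOrbit_iterate_setOrbitSeg {G : Type*} (f : G → G) (K : Set G) {n : ℕ} (hn : 0 < n) :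
    setOrbit f^[n] (setOrbitSeg f K n) = setOrbit f K := by
  ext x
  constructor
  · intro hx
    obtain ⟨m, y, hy, rfl⟩ := mem_iUnion.1 hx
    obtain ⟨i, -, k, hk, rfl⟩ := mem_iUnion₂.1 hy
    exact mem_iUnion.2 ⟨n * m + i, k, hk, by rw [iterate_add_apply, iterate_mul]⟩
  · intro hx
    obtain ⟨m, k, hk, rfl⟩ := mem_iUnion.1 hx
    refine mem_iUnion.2 ⟨m / n, f^[m % n] k,
      mem_iUnion₂.2 ⟨m % n, (Nat.mod_lt m hn).le, k, hk, rfl⟩, ?_⟩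
    rw [← iterate_mul, ← iterate_add_apply, Nat.div_add_mod]

/-- If the orbit of a continuum has two ends, each of them mapped into itself, then it contains a
periodic point. -/
theorem IsEndSystem.exists_mem_periodicPts {G ι : Type*} [TopologicalSpace G] [T2Space G] [Finite ι]
    [Nontrivial ι] {e : ι → ℝ → G} {g : G → G} {K : Set G} (h : IsEndSystem (setOrbit g K) e)
    (hg : Continuous g) (hK : IsConnected K) (hKc : IsCompact K)
    (hend : ∀ i, EndMap g e i i)
    (hfin : ∀ U : Set G, IsPreconnected U → (closure U \ U).Finite) :
    (setOrbit g K ∩ periodicPts g).Nonempty := by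
  by_contra hper
  have hper' : ∀ x ∈ setOrbit g K, x ∉ periodicPts g := fun x hx hxp => hper ⟨x, hx, hxp⟩
  have hgX := mapsTo_setOrbit g K
  have hKX := subset_setOrbit g K
  obtain ⟨i, j, hij⟩ := exists_pair_ne ι
  obtain ⟨s, hs, hsN⟩ := h.exists_image_subset_self hg hKc rfl hgX hend hper' i
  set N := e i '' Ioo 0 s
  have hNo : IsOpen N := (h.isFreeArc i).isOpen_image le_rfl hs.2
  have hNX : N ⊆ setOrbit g K := h.image_Ioo_subset i hs.2
  have hNc : IsPreconnected N := isPreconnected_Ioo.image _ ((h.isFreeArc i).continuousOn.mono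
    (Ioo_subset_Icc_self.trans (Icc_subset_Icc_right hs.2)))
  have hgN : MapsTo g N N := mapsTo_iff_image_subset.2 hsN
  set O := invOrbit g N
  have hOo : IsOpen O := isOpen_iUnion fun n => hNo.preimage (hg.iterate n)
  have hgO : MapsTo g O O := by
    intro x hx
    obtain ⟨n, hn⟩ := mem_iUnion.1 hx
    refine mem_iUnion.2 ⟨n, ?_⟩
    rw [mem_preimage, ← iterate_succ_apply, iterate_succ_apply']
    exact hgN hn
  have hgO' : MapsTo g Oᶜ Oᶜ := by
    intro x hx hgx
    obtain ⟨n, hn⟩ := mem_iUnion.1 hgx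
    exact hx (mem_iUnion.2 ⟨n + 1, hn⟩)
  have hKO : ¬K ⊆ O := by
    intro hKO
    have hmono : Monotone fun n => g^[n] ⁻¹' N := by
      refine monotone_nat_of_le_succ fun n x hx => ?_
      rw [mem_preimage, iterate_succ_apply']
      exact hgN hx
    obtain ⟨n, hn⟩ := hKc.elim_directed_cover _ (fun n => hNo.preimage (hg.iterate n)) hKO
      hmono.directed_le
    obtain ⟨r, hr, hd⟩ := h.exists_disjoint (C := ⋃ m ∈ Iio n, g^[m] '' K)
      ((finite_Iio n).isCompact_biUnion fun m _ => hKc.image (hg.iterate m))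
      (iUnion₂_subset fun m _ => subset_iUnion (fun m => g^[m] '' K) m) j
    have hjr : e j (r / 2) ∈ e j '' Ioo 0 r := ⟨_, ⟨half_pos hr.1, half_lt_self hr.1⟩, rfl⟩
    obtain ⟨m, k, hk, hkm⟩ := mem_iUnion.1 (h.image_Ioo_subset j hr.2 hjr)
    rcases lt_or_ge m n with hmn | hmn
    · exact disjoint_left.1 hd hjr (mem_iUnion₂.2 ⟨m, hmn, k, hk, hkm⟩)
    · have hmN : e j (r / 2) ∈ N := hkm ▸ hmono hmn (hn hk)
      exact hij (h.eq_of_mem (image_mono (Ioo_subset_Ioo_right hs.2) hmN)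
        (image_mono (Ioo_subset_Ioo_right hr.2) hjr))
  obtain ⟨n, k, hk, hkn⟩ := mem_iUnion.1 (hNX ⟨_, ⟨half_pos hs.1, half_lt_self hs.1⟩, rfl⟩)
  have hkN : g^[n] k ∈ N := hkn ▸ ⟨_, ⟨half_pos hs.1, half_lt_self hs.1⟩, rfl⟩
  obtain ⟨C, hCK, hC, hkC, p, hpC, hpK, hpO⟩ :=
    hK.exists_isPreconnected_bump hKc hOo hKO hk (mem_iUnion.2 ⟨n, hkN⟩)
  have hNO : N ⊆ O := fun x hx => mem_iUnion.2 ⟨0, hx⟩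
  set U := connectedComponentIn (setOrbit g K ∩ O) (g^[n] k)
  have hNU : N ⊆ U := hNc.subset_connectedComponentIn hkN (subset_inter hNX hNO)
  have hUO : U ⊆ setOrbit g K ∩ O := connectedComponentIn_subset _ _
  have hUc : IsPreconnected U := isPreconnected_connectedComponentIn
  have hgU : MapsTo g U U := by
    rw [mapsTo_iff_image_subset]
    have hz : g (g^[n] k) ∈ U := hNU (hgN hkN)
    have hUe : U = connectedComponentIn (setOrbit g K ∩ O) (g (g^[n] k)) :=
      connectedComponentIn_eq hz
    refine Subset.trans ?_ hUe.ge
    refine (hUc.image g hg.continuousOn).subset_connectedComponentIn ⟨_, hNU hkN, rfl⟩ ?_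
    exact image_subset_iff.2 fun x hx => ⟨hgX (hUO hx).1, hgO (hUO hx).2⟩
  have hCU : g^[n] '' C ⊆ U :=
    (hC.image _ (hg.iterate n).continuousOn).subset_connectedComponentIn ⟨k, hkC, rfl⟩
      (image_subset_iff.2 fun x hx => ⟨hgX.iterate n (hKX (hCK hx).1), hgO.iterate n (hCK hx).2⟩)
  have hF : MapsTo g ((setOrbit g K ∩ closure U) \ O) ((setOrbit g K ∩ closure U) \ O) :=
    fun x hx => ⟨⟨hgX hx.1.1, hgU.closure hg hx.1.2⟩, hgO' hx.2⟩
  obtain ⟨x, hx, hxp⟩ := hF.exists_mem_periodicPts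
    ((hfin U hUc).subset fun x hx => ⟨hx.1.2, fun hxU => hx.2 (hUO hxU).2⟩)
    ⟨g^[n] p, ⟨hgX.iterate n (hKX hpK), closure_mono hCU
      (image_closure_subset_closure_image (hg.iterate n) ⟨p, hpC, rfl⟩)⟩, hgO'.iterate n hpO⟩
  exact hper' x hx.1.1 hxp

/-- if `cl(X) − X` contains more than one point, where `X = O(K,f)` is the
orbit of a connected closed set `K` with `f(K) ∩ K ≠ ∅`, then `X ∩ P(f) ≠ ∅`. -/
theorem periodic_of_nontrivial_residual {G : Type*} [MetricSpace G] (V : Set G)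
    (hG : IsTopGraph V) (f : G → G) (hf : Continuous f) (K : Set G)
    (hKconn : IsConnected K) (hKclosed : IsClosed K)
    (hmeet : (f '' K ∩ K).Nonempty)
    (hnt : (closure (setOrbit f K) \ setOrbit f K).Nontrivial) :
    (setOrbit f K ∩ Function.periodicPts f).Nonempty := by
  have := hG.compact
  obtain ⟨ι, _, φ, hφ⟩ := hG.exists_isEdgeSystem
  have hX := (isConnected_setOrbit hf hKconn hmeet).isPreconnected
  obtain ⟨κ, _, _, e, he⟩ := hφ.exists_isEndSystem hX hnt
  have hres := mapsTo_closure_setOrbit_diff hf hKclosed (hφ.finite_closure_diff hX)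
  obtain ⟨N, hN, hend⟩ := he.exists_iterate_endMap hf (mapsTo_setOrbit f K)
    (fun _ hCX hC => isCompact_inter_preimage hf hres hCX hC) hKclosed.isCompact
    (subset_setOrbit f K) (setOrbit_subset_union_image f K)
  rw [← setOrbit_iterate_setOrbitSeg f K hN] at he ⊢
  obtain ⟨x, hx, n, hn, hxn⟩ := he.exists_mem_periodicPts (hf.iterate N)
    (isConnected_setOrbitSeg hf hKconn hmeet N) (isCompact_setOrbitSeg hf hKclosed.isCompact N)
    hend fun _ hU => hφ.finite_closure_diff hU
  refine ⟨x, hx, N * n, Nat.mul_pos hN hn, ?_⟩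
  rwa [IsPeriodicPt, iterate_mul]
end
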